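/- Let 1 < r < ∞ and 1 < p < ∞, and let (f_n)_{n≥1} be a sequence of measurable functions on ℝ^d such that (Σ_{n=1}^∞ |f_n(·)|^r)^{1/r} ∈ L^p(μ_κ). Then ‖(Σ_{n=1}^∞ |M_κ^R f_n(·)|^r)^{1/r}‖_{κ,p} ≤ C ‖(Σ_{n=1}^∞ |f_n(·)|^r)^{1/r}‖_{κ,p}, where C = C(κ_1,…,κ_d,r,p) is independent of (f_n). -/

import Mathlib

noncomputable section
open MeasureTheory Set Real
open scoped ENNReal NNReal

/-- one-dimensional measure `dμ_κ(x) = |x|^{2κ} dx` -/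
def muK1 (κ : ℝ) : Measure ℝ :=
  volume.withDensity fun x => ENNReal.ofReal (|x| ^ (2 * κ))

/-- the measure `μ_κ` on `ℝ^d` with density `∏_j |x_j|^{2κ_j}` -/
def muK (d : ℕ) (κ : Fin d → ℝ) : Measure (Fin d → ℝ) :=
  volume.withDensity fun x => ENNReal.ofReal (∏ j, |x j| ^ (2 * κ j))

/-- the constant `M_κ = Γ(κ+1/2)/(Γ(κ)Γ(1/2))` -/
def Mconst (κ : ℝ) : ℝ := Real.Gamma (κ + 1/2) / (Real.Gamma κ * Real.Gamma (1/2))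

/-- `σ_{x,y,z}` -/
def sigma3 (x y z : ℝ) : ℝ := if x ≠ 0 ∧ y ≠ 0 then (x^2 + y^2 - z^2) / (2*x*y) else 0

/-- area of the (possibly degenerate) triangle with side lengths `x,y,z` (Heron) -/
def triArea (x y z : ℝ) : ℝ :=
  Real.sqrt (((x+y+z)/2) * ((x+y+z)/2 - x) * ((x+y+z)/2 - y) * ((x+y+z)/2 - z))

/-- the kernel `K_κ(x,y,z)` -/
def Kker (κ x y z : ℝ) : ℝ :=
  if |x - y| ≤ z ∧ z ≤ x + y then
    (2:ℝ) ^ (2*κ - 2) * Mconst κ * triArea x y z ^ (2*κ - 2) * (x*y*z) ^ (1 - 2*κ)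
  else 0

/-- density of the measure `ν^{κ,+}_{x,y}` with respect to Lebesgue measure -/
def nuDens (κ x y z : ℝ) : ℝ≥0∞ :=
  ENNReal.ofReal ((1/2) * Kker κ |x| |y| |z| * (1 - sigma3 x y z) * |z| ^ (2*κ))

/-- the measure `ν^{κ,+}_{x,y}` -/
def nuPlus (κ x y : ℝ) : Measure ℝ := volume.withDensity (nuDens κ x y)

/-- the product measure `υ^κ_{x,y} = ν^{κ_1,+}_{x_1,y_1} ⊗ ⋯ ⊗ ν^{κ_d,+}_{x_d,y_d}` -/
def upsilon (d : ℕ) (κ x y : Fin d → ℝ) : Measure (Fin d → ℝ) :=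
  volume.withDensity fun z => ∏ j, nuDens (κ j) (x j) (y j) (z j)

/-- the set `ℝ^d_reg` of regular points -/
def regSet (d : ℕ) : Set (Fin d → ℝ) := {x | ∀ j, x j ≠ 0}

/-- the Euclidean ball of radius `r` centered at the origin -/
def eBall (d : ℕ) (r : ℝ) : Set (Fin d → ℝ) := {x | ∑ j, (x j)^2 < r^2}

/-- the open cube `Q_r` -/
def cubeQ (d : ℕ) (r : ℝ) : Set (Fin d → ℝ) := {x | ∀ j, |x j| < r}

/-- the constant `c_κ` with `c_κ⁻¹ = ∫ e^{-‖x‖²/2} dμ_κ` -/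
def cKappa (d : ℕ) (κ : Fin d → ℝ) : ℝ :=
  (∫ x, Real.exp (-(∑ j, (x j)^2) / 2) ∂(muK d κ))⁻¹

open Classical in
/-- the `ℤ_2^d` Dunkl maximal operator (explicit form), vanishing off `ℝ^d_reg` -/
def Mdunkl (d : ℕ) (κ : Fin d → ℝ) (f : (Fin d → ℝ) → ℝ) (x : Fin d → ℝ) : ℝ≥0∞ :=
  if x ∈ regSet d then
    ⨆ (r : ℝ) (_ : 0 < r), ENNReal.ofReal
      ((cKappa d κ / (muK d κ (eBall d r)).toReal) *
        |∫ y in regSet d, f y * (upsilon d κ x (-y) (eBall d r)).toReal ∂(muK d κ)|)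
  else 0

/-- the cube Dunkl maximal operator `M_κ^Q` (explicit form) -/
def MdunklQ (d : ℕ) (κ : Fin d → ℝ) (f : (Fin d → ℝ) → ℝ) (x : Fin d → ℝ) : ℝ≥0∞ :=
  ⨆ (r : ℝ) (_ : 0 < r), ENNReal.ofReal
    ((cKappa d κ / (muK d κ (cubeQ d r)).toReal) *
      |∫ y in regSet d, f y * (upsilon d κ x (-y) (cubeQ d r)).toReal ∂(muK d κ)|)

/-- the interval `I(x,r) = [max{0,|x|-r}, |x|+r)` -/
def Iset (x r : ℝ) : Set ℝ := Set.Ico (max 0 (|x| - r)) (|x| + r)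

/-- the rectangle `R(z,r) = I(z_1,r) × ⋯ × I(z_d,r)` -/
def Rset (d : ℕ) (z : Fin d → ℝ) (r : ℝ) : Set (Fin d → ℝ) :=
  Set.univ.pi fun j => Iset (z j) r

/-- the weighted maximal operator `M_κ^R` -/
def MR (d : ℕ) (κ : Fin d → ℝ) (f : (Fin d → ℝ) → ℝ) (x : Fin d → ℝ) : ℝ≥0∞ :=
  ⨆ (r : ℝ) (_ : 0 < r),
    (muK d κ (Rset d x r))⁻¹ *
      ∫⁻ y in {y | (fun j => |y j|) ∈ Rset d x r}, ENNReal.ofReal |f y| ∂(muK d κ)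

/-- Rösler's explicit formula for the one-dimensional Dunkl translation `τ_x^κ f(y)` -/
def tauK (κ x : ℝ) (f : ℝ → ℝ) (y : ℝ) : ℝ :=
  (1/2) * (∫ t in Set.Ioo (-1:ℝ) 1,
      f (Real.sqrt (x^2 + y^2 + 2*x*y*t)) *
        (1 + (x + y) / Real.sqrt (x^2 + y^2 + 2*x*y*t)) *
        (Mconst κ * (1 + t) * (1 - t^2) ^ (κ - 1)))
  + (1/2) * (∫ t in Set.Ioo (-1:ℝ) 1,
      f (-Real.sqrt (x^2 + y^2 + 2*x*y*t)) *
        (1 - (x + y) / Real.sqrt (x^2 + y^2 + 2*x*y*t)) *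
        (Mconst κ * (1 + t) * (1 - t^2) ^ (κ - 1)))

/-- an `ℝ≥0∞`-valued `L^p` norm for `ℝ≥0∞`-valued functions -/
def lpNormE {α : Type*} [MeasurableSpace α] (g : α → ℝ≥0∞) (p : ℝ≥0∞) (μ : Measure α) : ℝ≥0∞ :=
  if p = ∞ then essSup g μ else (∫⁻ x, g x ^ p.toReal ∂μ) ^ (1 / p.toReal)

/-- the Hardy–Littlewood maximal operator over cubes centered at `x` -/
def HLmax (d : ℕ) (f : (Fin d → ℝ) → ℝ) (x : Fin d → ℝ) : ℝ≥0∞ :=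
  ⨆ (r : ℝ) (_ : 0 < r),
    (volume {y : Fin d → ℝ | ∀ j, |y j - x j| < r})⁻¹ *
      ∫⁻ y in {y : Fin d → ℝ | ∀ j, |y j - x j| < r}, ENNReal.ofReal |f y| ∂volume

theorem ENNReal.sum_rpow_le_card_rpow_mul_sum {α : Type*} (s : Finset α) (a : α → ℝ≥0∞) {q : ℝ}
    (hq : 0 < q) : (∑ i ∈ s, a i) ^ q ≤ (s.card : ℝ≥0∞) ^ q * ∑ i ∈ s, a i ^ q := by
  have h : ∀ i ∈ s, a i ≤ (∑ i ∈ s, a i ^ q) ^ q⁻¹ := fun i hi => by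
    rw [ENNReal.le_rpow_inv_iff hq]
    exact Finset.single_le_sum_of_canonicallyOrdered (f := fun i => a i ^ q) hi
  calc (∑ i ∈ s, a i) ^ q ≤ (s.card * (∑ i ∈ s, a i ^ q) ^ q⁻¹) ^ q := by
        gcongr
        rw [← nsmul_eq_mul]
        exact Finset.sum_le_card_nsmul _ _ _ h
    _ = _ := by rw [ENNReal.mul_rpow_of_nonneg _ _ hq.le, ENNReal.rpow_inv_rpow hq.ne']

section Dyadic

variable {X ι : Type*}

/-- the cell containing `x` of the partition of `X` into the fibres of `c k` -/
def dyadicCell (c : ℤ → X → ι) (k : ℤ) (x : X) : Set X := c k ⁻¹' {c k x}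

theorem dyadicCell_eq_of_mem {c : ℤ → X → ι} {k : ℤ} {x y : X} (h : y ∈ dyadicCell c k x) :
    dyadicCell c k y = dyadicCell c k x := by
  have h' : c k y = c k x := h
  simp [dyadicCell, h']

variable [MeasurableSpace X]

/-- the average of `f` over the cell of `x` at level `k` -/
def dyadicAvg (c : ℤ → X → ι) (w : Measure X) (f : X → ℝ≥0∞) (k : ℤ) (x : X) : ℝ≥0∞ :=
  (w (dyadicCell c k x))⁻¹ * ∫⁻ y in dyadicCell c k x, f y ∂w

/-- the maximal operator, relative to the measure `w`, over the cells of the partitions `c k` -/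
def dyadicMax (c : ℤ → X → ι) (w : Measure X) (f : X → ℝ≥0∞) (x : X) : ℝ≥0∞ :=
  ⨆ k, dyadicAvg c w f k x

theorem dyadicAvg_le_dyadicMax (c : ℤ → X → ι) (w : Measure X) (f : X → ℝ≥0∞) (k : ℤ) (x : X) :
    dyadicAvg c w f k x ≤ dyadicMax c w f x :=
  le_iSup (fun k => dyadicAvg c w f k x) k

theorem dyadicMax_le_add (c : ℤ → X → ι) (w : Measure X) {f g : X → ℝ≥0∞} {a : ℝ≥0∞}
    (hg : Measurable g) (hfg : ∀ x, f x ≤ g x + a) (x : X) :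
    dyadicMax c w f x ≤ dyadicMax c w g x + a := by
  refine iSup_le fun k => ?_
  calc dyadicAvg c w f k x
      ≤ (w (dyadicCell c k x))⁻¹ * ∫⁻ y in dyadicCell c k x, (g y + a) ∂w := by
        unfold dyadicAvg
        gcongr
        exact hfg _
    _ = dyadicAvg c w g k x + (w (dyadicCell c k x))⁻¹ * w (dyadicCell c k x) * a := by
        rw [lintegral_add_left hg, mul_add, setLIntegral_const, mul_comm a, mul_assoc]
        rfl
    _ ≤ dyadicMax c w g x + 1 * a := by
        gcongr
        · exact dyadicAvg_le_dyadicMax c w g k x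
        · exact ENNReal.inv_mul_le_one _
    _ = _ := by rw [one_mul]

theorem dyadicMax_tsum_le (c : ℤ → X → ι) {μ : Measure X} {g : ℕ → X → ℝ≥0∞}
    (hg : ∀ n, Measurable (g n)) (x : X) :
    dyadicMax c μ (fun y => ∑' n, g n y) x ≤ ∑' n, dyadicMax c μ (g n) x := by
  refine iSup_le fun k => ?_
  rw [dyadicAvg, lintegral_tsum fun n => (hg n).aemeasurable, ← ENNReal.tsum_mul_left]
  exact ENNReal.tsum_le_tsum fun n => dyadicAvg_le_dyadicMax c μ (g n) k x

theorem dyadicMax_const_mul (c : ℤ → X → ι) {μ : Measure X} {g : X → ℝ≥0∞}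
    (hg : Measurable g) (a : ℝ≥0∞) (x : X) :
    dyadicMax c μ (fun y => a * g y) x = a * dyadicMax c μ g x := by
  simp only [dyadicMax, dyadicAvg, ENNReal.mul_iSup]
  refine iSup_congr fun k => ?_
  rw [lintegral_const_mul _ hg]
  ring

theorem lintegral_dyadicCell_le {c : ℤ → X → ι} {μ : Measure X} {w : X → ℝ≥0∞} {k : ℤ} {x : X}
    {a : ℝ≥0∞} (hμ : μ (dyadicCell c k x) ≠ ∞) (h : dyadicMax c μ w x ≤ a) :
    ∫⁻ y in dyadicCell c k x, w y ∂μ ≤ a * μ (dyadicCell c k x) := by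
  rcases eq_or_ne (μ (dyadicCell c k x)) 0 with h0 | h0
  · simp [Measure.restrict_eq_zero.2 h0]
  have h1 := (dyadicAvg_le_dyadicMax c μ w k x).trans h
  rw [dyadicAvg, mul_comm, ← div_eq_mul_inv] at h1
  exact (ENNReal.div_le_iff h0 hμ).1 h1

/-- a power of exponent in `(0, 1)` of an `A₁` weight is an `A₁` weight -/
theorem lintegral_dyadicCell_rpow_le {c : ℤ → X → ι} {μ : Measure X} {w : X → ℝ≥0∞}
    (hw : Measurable w) {θ : ℝ} (hθ : 0 < θ) (hθ1 : θ < 1) {k : ℤ} {x : X} {a : ℝ≥0∞}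
    (h : ∫⁻ y in dyadicCell c k x, w y ∂μ ≤ a * w x * μ (dyadicCell c k x)) :
    ∫⁻ y in dyadicCell c k x, w y ^ θ ∂μ ≤ a ^ θ * w x ^ θ * μ (dyadicCell c k x) := by
  have hconj : (1 / θ).HolderConjugate (1 / (1 - θ)) := by
    rw [Real.holderConjugate_iff]
    refine ⟨by rw [lt_div_iff₀ hθ]; linarith, by simp⟩
  have := ENNReal.lintegral_mul_le_Lp_mul_Lq (μ.restrict (dyadicCell c k x)) hconj
    (f := fun y => w y ^ θ) (g := fun _ => 1) (hw.pow_const θ).aemeasurable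
    aemeasurable_const
  simp only [Pi.mul_apply, mul_one, one_div, inv_inv, ENNReal.one_rpow, lintegral_const,
    Measure.restrict_apply_univ, one_mul, ENNReal.rpow_rpow_inv hθ.ne'] at this
  refine this.trans ?_
  calc (∫⁻ y in dyadicCell c k x, w y ∂μ) ^ θ * μ (dyadicCell c k x) ^ (1 - θ)
      ≤ (a * w x * μ (dyadicCell c k x)) ^ θ * μ (dyadicCell c k x) ^ (1 - θ) := by gcongr
    _ = a ^ θ * w x ^ θ * μ (dyadicCell c k x) := by
      rw [ENNReal.mul_rpow_of_nonneg _ _ hθ.le, ENNReal.mul_rpow_of_nonneg _ _ hθ.le, mul_assoc,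
        ← ENNReal.rpow_add_of_nonneg _ _ hθ.le (by linarith), add_sub_cancel, ENNReal.rpow_one]

theorem ae_measure_dyadicCell_ne_zero [Countable ι] (c : ℤ → X → ι) (w : Measure X) :
    ∀ᵐ x ∂w, ∀ k, w (dyadicCell c k x) ≠ 0 := by
  refine ae_all_iff.2 fun k => ?_
  have h : {x | ¬ w (dyadicCell c k x) ≠ 0} ⊆ ⋃ i ∈ {i | w (c k ⁻¹' {i}) = 0}, c k ⁻¹' {i} := by
    intro x hx
    have hx' : w (c k ⁻¹' {c k x}) = 0 := not_not.1 hx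
    exact mem_biUnion (show c k x ∈ {i | w (c k ⁻¹' {i}) = 0} from hx') rfl
  exact measure_mono_null h ((measure_biUnion_null_iff (to_countable _)).2 fun i hi => hi)

/-- each partition `c (k + 1)` is measurable and refines `c k` -/
structure IsDyadicSystem [MeasurableSpace ι] (c : ℤ → X → ι) : Prop where
  measurable : ∀ k, Measurable (c k)
  refines : ∀ k x y, c (k + 1) y = c (k + 1) x → c k y = c k x

variable [MeasurableSpace ι] {c : ℤ → X → ι}

theorem IsDyadicSystem.eq_of_le (hc : IsDyadicSystem c) {j k : ℤ} (hjk : j ≤ k) {x y : X}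
    (h : c k y = c k x) : c j y = c j x := by
  induction k, hjk using Int.leInduction with
  | base => exact h
  | succ k _ ih => exact ih (hc.refines k x y h)

variable [MeasurableSingletonClass ι]

theorem IsDyadicSystem.measurableSet_cell (hc : IsDyadicSystem c) (k : ℤ) (x : X) :
    MeasurableSet (dyadicCell c k x) :=
  hc.measurable k (measurableSet_singleton _)

variable [Countable ι]

theorem IsDyadicSystem.measurable_avg (hc : IsDyadicSystem c) (w : Measure X) (f : X → ℝ≥0∞)
    (k : ℤ) : Measurable (dyadicAvg c w f k) :=
  (Measurable.of_discrete
    (f := fun i : ι => (w (c k ⁻¹' {i}))⁻¹ * ∫⁻ y in c k ⁻¹' {i}, f y ∂w)).comp (hc.measurable k)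

theorem IsDyadicSystem.measurable_max (hc : IsDyadicSystem c) (w : Measure X) (f : X → ℝ≥0∞) :
    Measurable (dyadicMax c w f) :=
  Measurable.iSup fun k => hc.measurable_avg w f k

theorem IsDyadicSystem.mul_measure_preimage_le (hc : IsDyadicSystem c) {w : Measure X}
    {f : X → ℝ≥0∞} {t : ℝ≥0∞} {k : ℤ} {T : Set ι}
    (h : ∀ x, c k x ∈ T → t < dyadicAvg c w f k x) :
    t * w (c k ⁻¹' T) ≤ ∫⁻ x in c k ⁻¹' T, f x ∂w := by
  have hT : c k ⁻¹' T = ⋃ i ∈ T, c k ⁻¹' {i} := by ext; simp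
  have hd : T.PairwiseDisjoint fun i => c k ⁻¹' {i} := fun i _ j _ hij =>
    Disjoint.preimage _ (by simpa using hij)
  have hm : ∀ i ∈ T, MeasurableSet (c k ⁻¹' {i}) := fun i _ =>
    hc.measurable k (measurableSet_singleton _)
  rw [hT, measure_biUnion (to_countable T) hd hm, lintegral_biUnion (to_countable T) hm hd,
    ← ENNReal.tsum_mul_left]
  refine ENNReal.tsum_le_tsum fun ⟨i, hi⟩ => ?_
  rcases (c k ⁻¹' {i}).eq_empty_or_nonempty with he | ⟨x, hx⟩
  · simp [he]
  have hx' : c k x = i := hx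
  have := h x (hx' ▸ hi)
  rw [dyadicAvg, dyadicCell, hx', mul_comm, ← div_eq_mul_inv] at this
  have hle := this.le
  exact ENNReal.mul_le_of_le_div hle

/-- the weak type `(1,1)` inequality for the dyadic maximal operator, with constant one -/
theorem IsDyadicSystem.mul_measure_lt_max_le (hc : IsDyadicSystem c) (w : Measure X)
    (f : X → ℝ≥0∞) (t : ℝ≥0∞) :
    t * w {x | t < dyadicMax c w f x} ≤ ∫⁻ x, f x ∂w := by
  set E : ℤ → Set X := fun k => {x | t < dyadicAvg c w f k x} with hE
  have hEm : ∀ k, MeasurableSet (E k) := fun k =>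
    measurableSet_lt measurable_const (hc.measurable_avg w f k)
  have hEc : ∀ {j k : ℤ} {x y : X}, j ≤ k → c k y = c k x → y ∈ E j → x ∈ E j := by
    intro j k x y hjk hxy hy
    have h1 := dyadicCell_eq_of_mem (c := c) (k := j) (x := x) (y := y) (hc.eq_of_le hjk hxy)
    simpa [hE, dyadicAvg, h1] using hy
  have hlevel : ∀ N : ℕ, t * w (⋃ j : ℕ, E (j - N)) ≤ ∫⁻ x, f x ∂w := by
    intro N
    set D : ℕ → Set X := disjointed fun j : ℕ => E (j - N) with hD
    have hDm : ∀ j, MeasurableSet (D j) := MeasurableSet.disjointed fun j => hEm _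
    have hDd : Pairwise (Function.onFun Disjoint D) := disjoint_disjointed _
    have hDj : ∀ j, t * w (D j) ≤ ∫⁻ x in D j, f x ∂w := by
      intro j
      have hpre : D j = c (j - N) ⁻¹' (c (j - N) '' D j) := by
        refine subset_antisymm (subset_preimage_image _ _) ?_
        rintro x ⟨y, hy, hxy⟩
        rw [hD, disjointed_eq_inter_compl] at hy ⊢
        refine ⟨hEc le_rfl hxy hy.1, mem_iInter₂.2 fun i hi hxi => ?_⟩
        refine (mem_iInter₂.1 hy.2 i hi) (hEc (k := j - N) ?_ hxy.symm hxi)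
        have : (i : ℤ) < j := by exact_mod_cast hi
        linarith
      rw [hpre]
      refine hc.mul_measure_preimage_le ?_
      rintro x ⟨y, hy, hxy⟩
      exact hEc le_rfl hxy (disjointed_subset (fun j : ℕ => E (j - N)) j hy)
    rw [← iUnion_disjointed, measure_iUnion hDd hDm, ← ENNReal.tsum_mul_left]
    calc ∑' j, t * w (D j) ≤ ∑' j, ∫⁻ x in D j, f x ∂w := ENNReal.tsum_le_tsum hDj
      _ = ∫⁻ x in ⋃ j, D j, f x ∂w := (lintegral_iUnion hDm hDd f).symm
      _ ≤ ∫⁻ x, f x ∂w := setLIntegral_le_lintegral _ _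
  have hset : {x | t < dyadicMax c w f x} = ⋃ N : ℕ, ⋃ j : ℕ, E (j - N) := by
    ext x
    simp only [dyadicMax, mem_ofPred_eq, lt_iSup_iff, mem_iUnion, hE]
    constructor
    · rintro ⟨k, hk⟩
      refine ⟨k.natAbs, (k + k.natAbs).toNat, ?_⟩
      have : (((k + k.natAbs).toNat : ℤ) - (k.natAbs : ℤ)) = k := by omega
      rwa [this]
    · rintro ⟨N, j, h⟩
      exact ⟨_, h⟩
  have hmono : Monotone fun N : ℕ => ⋃ j : ℕ, E (j - N) := by
    intro M N hMN
    refine iUnion_subset fun j => ?_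
    have : ((j : ℤ) - M) = ((j + (N - M) : ℕ) : ℤ) - N := by omega
    rw [this]
    exact subset_iUnion (fun j : ℕ => E (j - N)) _
  rw [hset, hmono.measure_iUnion, ENNReal.mul_iSup]
  exact iSup_le hlevel

theorem ENNReal.rpow_le_tsum_two_zpow {p : ℝ} (hp : 0 < p) (m : ℝ≥0∞) :
    m ^ p ≤ ∑' j : ℤ, if 2 * (2 : ℝ≥0∞) ^ j < m then (4 * (2 : ℝ≥0∞) ^ j) ^ p else 0 := by
  rcases eq_or_ne m 0 with rfl | h0
  · simp [ENNReal.zero_rpow_of_pos hp]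
  rcases eq_or_ne m ∞ with rfl | ht
  · have hfin : ∀ j : ℤ, 2 * (2 : ℝ≥0∞) ^ j < ∞ := fun j =>
      ENNReal.mul_lt_top (by simp) (ENNReal.zpow_lt_top (by simp) (by simp) j)
    simp only [hfin, if_true]
    have h1 : (∑' _ : ℕ, (1 : ℝ≥0∞)) = ∞ := ENNReal.tsum_const_eq_top_of_ne_zero one_ne_zero
    have h2 : (∑' _ : ℕ, (1 : ℝ≥0∞)) ≤ ∑' j : ℕ, (4 * (2 : ℝ≥0∞) ^ (j : ℤ)) ^ p := by
      refine ENNReal.tsum_le_tsum fun j => ENNReal.one_le_rpow ?_ hp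
      rw [zpow_natCast]
      exact one_le_mul (by norm_num) (one_le_pow₀ (by norm_num))
    rw [h1] at h2
    exact le_top.trans (h2.trans
      (ENNReal.tsum_comp_le_tsum_of_injective (f := ((↑) : ℕ → ℤ)) Nat.cast_injective _))
  obtain ⟨n, hn1, hn2⟩ := ENNReal.exists_mem_Ioc_zpow h0 ht ENNReal.one_lt_two (by simp)
  refine le_trans ?_ (ENNReal.le_tsum (n - 1))
  have h2 : 2 * (2 : ℝ≥0∞) ^ (n - 1) = 2 ^ n := by
    nth_rw 1 [← zpow_one (2 : ℝ≥0∞)]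
    rw [← ENNReal.zpow_add (by simp) (by simp)]
    congr 1; ring
  have h4 : 4 * (2 : ℝ≥0∞) ^ (n - 1) = 2 ^ (n + 1) := by
    rw [show (4 : ℝ≥0∞) = 2 * 2 by norm_num, mul_assoc, h2, mul_comm,
      ENNReal.zpow_add (by simp) (by simp), zpow_one]
  rw [h2, if_pos hn1, h4]
  exact ENNReal.rpow_le_rpow hn2 hp.le

theorem ENNReal.exists_mul_tsum_two_zpow_le {p : ℝ} (hp : 1 < p) :
    ∃ K : ℝ≥0, ∀ b : ℝ≥0∞,
      ∑' j : ℤ, (if (2 : ℝ≥0∞) ^ j < b then ((2 : ℝ≥0∞) ^ j) ^ (p - 1) else 0) * b ≤ K * b ^ p := by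
  set ρ : ℝ≥0∞ := (2⁻¹ : ℝ≥0∞) ^ (p - 1) with hρ
  have hρ1 : ρ < 1 := ENNReal.rpow_lt_one (by simp) (by linarith)
  have hK : (1 - ρ)⁻¹ ≠ ∞ := ENNReal.inv_ne_top.2 (tsub_pos_of_lt hρ1).ne'
  refine ⟨(1 - ρ)⁻¹.toNNReal + 1, fun b => ?_⟩
  rcases eq_or_ne b 0 with rfl | h0
  · simp
  rcases eq_or_ne b ∞ with rfl | ht
  · rw [ENNReal.top_rpow_of_pos (by linarith), ENNReal.mul_top]
    · exact le_top
    · simp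
  obtain ⟨n, hn1, hn2⟩ := ENNReal.exists_mem_Ioc_zpow h0 ht ENNReal.one_lt_two (by simp)
  have hterm : ∀ i : ℕ, ((2 : ℝ≥0∞) ^ (n - (i : ℤ))) ^ (p - 1) ≤ b ^ (p - 1) * ρ ^ i := by
    intro i
    rw [sub_eq_add_neg, ENNReal.zpow_add (by simp) (by simp),
      ENNReal.mul_rpow_of_nonneg _ _ (by linarith : 0 ≤ p - 1)]
    refine mul_le_mul' (ENNReal.rpow_le_rpow hn1.le (by linarith)) (le_of_eq ?_)
    rw [hρ, ENNReal.zpow_neg, zpow_natCast, ENNReal.inv_pow, ← ENNReal.rpow_natCast,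
      ← ENNReal.rpow_mul, ← ENNReal.rpow_natCast, ← ENNReal.rpow_mul, mul_comm]
  rw [ENNReal.tsum_mul_right]
  have hsum : ∑' j : ℤ, (if (2 : ℝ≥0∞) ^ j < b then ((2 : ℝ≥0∞) ^ j) ^ (p - 1) else 0)
      ≤ ∑' i : ℕ, b ^ (p - 1) * ρ ^ i := by
    have hinj : Function.Injective fun i : ℕ => n - (i : ℤ) := fun i j h => by
      simpa using h
    rw [← hinj.tsum_eq]
    · refine ENNReal.tsum_le_tsum fun i => ?_
      split_ifs
      · exact hterm i
      · exact zero_le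
    · intro j hj
      have hj' : (2 : ℝ≥0∞) ^ j < b := by
        by_contra h
        simp [h] at hj
      have : j < n + 1 := by
        by_contra! h
        exact absurd (hj'.trans_le hn2) (not_lt.2 (ENNReal.zpow_le_of_le (by norm_num) h))
      exact ⟨(n - j).toNat, by simp; omega⟩
  calc _ ≤ (∑' i : ℕ, b ^ (p - 1) * ρ ^ i) * b := by gcongr
    _ = (1 - ρ)⁻¹ * b ^ p := by
      rw [ENNReal.tsum_mul_left, ENNReal.tsum_geometric, mul_comm _ (1 - ρ)⁻¹, mul_assoc]
      congr 1
      nth_rw 2 [← ENNReal.rpow_one b]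
      rw [← ENNReal.rpow_add _ _ h0 ht]
      congr 1; ring
    _ ≤ _ := by
      gcongr
      rw [ENNReal.coe_add, ENNReal.coe_toNNReal hK]
      exact le_self_add

/-- Doob's `L^p` inequality for the dyadic maximal operator, with a constant independent of the
measure -/
theorem IsDyadicSystem.exists_lintegral_max_rpow_le {p : ℝ} (hp : 1 < p) :
    ∃ A : ℝ≥0, ∀ c : ℤ → X → ι, IsDyadicSystem c → ∀ (w : Measure X) (f : X → ℝ≥0∞), Measurable f →
      ∫⁻ x, dyadicMax c w f x ^ p ∂w ≤ A * ∫⁻ x, f x ^ p ∂w := by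
  obtain ⟨K, hK⟩ := ENNReal.exists_mul_tsum_two_zpow_le hp
  refine ⟨(4 : ℝ≥0) ^ p * K, fun c hc w f hf => ?_⟩
  have hp0 : 0 < p := by linarith
  have hM := hc.measurable_max w f
  have hm : ∀ a : ℝ≥0∞, MeasurableSet {x | a < f x} := fun a => measurableSet_lt measurable_const hf
  have hweak : ∀ j : ℤ, (2 : ℝ≥0∞) ^ j * w {x | 2 * (2 : ℝ≥0∞) ^ j < dyadicMax c w f x}
      ≤ ∫⁻ x, {x | (2 : ℝ≥0∞) ^ j < f x}.indicator f x ∂w := by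
    intro j
    set a := (2 : ℝ≥0∞) ^ j with ha
    have hle : ∀ x, f x ≤ {x | a < f x}.indicator f x + a := by
      intro x
      by_cases hx : a < f x
      · simp [indicator, hx]
      · simpa [indicator, hx] using not_lt.1 hx
    refine le_trans ?_ (hc.mul_measure_lt_max_le w _ a)
    refine mul_le_mul_right (measure_mono fun x hx => ?_) a
    have hx' : 2 * a < dyadicMax c w f x := hx
    have h := hx'.trans_le (dyadicMax_le_add c w (hf.indicator (hm a)) hle x)
    rw [two_mul] at h
    exact lt_of_add_lt_add_right h
  calc ∫⁻ x, dyadicMax c w f x ^ p ∂w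
      ≤ ∫⁻ x, ∑' j : ℤ, {x | 2 * (2 : ℝ≥0∞) ^ j < dyadicMax c w f x}.indicator
          (fun _ => (4 * (2 : ℝ≥0∞) ^ j) ^ p) x ∂w :=
        lintegral_mono fun x => by
          simpa only [indicator, mem_ofPred_eq] using
            ENNReal.rpow_le_tsum_two_zpow hp0 (dyadicMax c w f x)
    _ = ∑' j : ℤ, (4 * (2 : ℝ≥0∞) ^ j) ^ p * w {x | 2 * (2 : ℝ≥0∞) ^ j < dyadicMax c w f x} := by
        have hmj : ∀ j : ℤ, MeasurableSet {x | 2 * (2 : ℝ≥0∞) ^ j < dyadicMax c w f x} := fun j =>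
          measurableSet_lt measurable_const hM
        rw [lintegral_tsum fun j => (measurable_const.indicator (hmj j)).aemeasurable]
        exact tsum_congr fun j => lintegral_indicator_const (hmj j) _
    _ ≤ ∑' j : ℤ, 4 ^ p * (((2 : ℝ≥0∞) ^ j) ^ (p - 1) *
          ∫⁻ x, {x | (2 : ℝ≥0∞) ^ j < f x}.indicator f x ∂w) := by
        refine ENNReal.tsum_le_tsum fun j => ?_
        have h0 : (2 : ℝ≥0∞) ^ j ≠ 0 := (ENNReal.zpow_pos (by simp) (by simp) j).ne'
        have ht : (2 : ℝ≥0∞) ^ j ≠ ∞ := (ENNReal.zpow_lt_top (by simp) (by simp) j).ne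
        have hsplit : ((2 : ℝ≥0∞) ^ j) ^ p = ((2 : ℝ≥0∞) ^ j) ^ (p - 1) * (2 : ℝ≥0∞) ^ j := by
          nth_rw 3 [← ENNReal.rpow_one ((2 : ℝ≥0∞) ^ j)]
          rw [← ENNReal.rpow_add _ _ h0 ht, sub_add_cancel]
        rw [ENNReal.mul_rpow_of_nonneg _ _ hp0.le, hsplit, mul_assoc, mul_assoc]
        gcongr
        exact hweak j
    _ = 4 ^ p * ∫⁻ x, ∑' j : ℤ,
          (if (2 : ℝ≥0∞) ^ j < f x then ((2 : ℝ≥0∞) ^ j) ^ (p - 1) else 0) * f x ∂w := by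
        rw [ENNReal.tsum_mul_left]
        congr 1
        have hmi : ∀ j : ℤ, Measurable ({x | (2 : ℝ≥0∞) ^ j < f x}.indicator f) := fun j =>
          hf.indicator (hm _)
        simp_rw [← lintegral_const_mul _ (hmi _)]
        rw [← lintegral_tsum fun j => ((hmi j).const_mul _).aemeasurable]
        refine lintegral_congr fun x => tsum_congr fun j => ?_
        by_cases h : (2 : ℝ≥0∞) ^ j < f x <;> simp [indicator, h]
    _ ≤ 4 ^ p * ∫⁻ x, K * f x ^ p ∂w := by
        gcongr with x
        exact hK _
    _ = _ := by
        rw [lintegral_const_mul _ (hf.pow_const p), ← mul_assoc, ENNReal.coe_mul,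
          ENNReal.coe_rpow_of_nonneg _ hp0.le]
        norm_num

theorem lintegral_rpow_tsum_le_tsum {α : Type*} [MeasurableSpace α] {μ : Measure α} {s : ℝ}
    (hs : 1 ≤ s) {g : ℕ → α → ℝ≥0∞} (hg : ∀ n, Measurable (g n)) :
    (∫⁻ x, (∑' n, g n x) ^ s ∂μ) ^ (1 / s) ≤ ∑' n, (∫⁻ x, g n x ^ s ∂μ) ^ (1 / s) := by
  have hs0 : 0 < s := by linarith
  have hfin : ∀ n, (∫⁻ x, (∑ i ∈ Finset.range n, g i x) ^ s ∂μ) ^ (1 / s)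
      ≤ ∑ i ∈ Finset.range n, (∫⁻ x, g i x ^ s ∂μ) ^ (1 / s) := by
    intro n
    induction n with
    | zero => simp [hs0]
    | succ n ih =>
      simp only [Finset.sum_range_succ]
      refine (ENNReal.lintegral_Lp_add_le (f := fun x => ∑ i ∈ Finset.range n, g i x) (g := g n)
        (Finset.measurable_fun_sum _ fun i _ => hg i).aemeasurable (hg n).aemeasurable hs).trans ?_
      gcongr
  have hsup : ∫⁻ x, (∑' n, g n x) ^ s ∂μ = ⨆ n, ∫⁻ x, (∑ i ∈ Finset.range n, g i x) ^ s ∂μ := by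
    rw [← lintegral_iSup (fun n => (Finset.measurable_fun_sum _ fun i _ => hg i).pow_const s)
      (fun m n hmn x => by
        dsimp only
        gcongr)]
    refine lintegral_congr fun x => ?_
    rw [ENNReal.tsum_eq_iSup_nat]
    exact (ENNReal.orderIsoRpow s hs0).map_iSup _
  have hsup' := (ENNReal.orderIsoRpow (1 / s) (by positivity)).map_iSup
    (fun n => ∫⁻ x, (∑ i ∈ Finset.range n, g i x) ^ s ∂μ)
  simp only [ENNReal.orderIsoRpow_apply] at hsup'
  rw [hsup, hsup']
  exact iSup_le fun n => (hfin n).trans (ENNReal.sum_le_tsum _)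

/-- the Rubio de Francia algorithm: every function has a majorant of comparable `L^s` norm which
is an `A₁` weight -/
theorem IsDyadicSystem.exists_majorant {s : ℝ} (hs : 1 < s) :
    ∃ A : ℝ≥0, ∀ c : ℤ → X → ι, IsDyadicSystem c → ∀ (μ : Measure X) (h : X → ℝ≥0∞), Measurable h →
      ∃ w : X → ℝ≥0∞, Measurable w ∧ (∀ x, h x ≤ w x) ∧ (∀ x, dyadicMax c μ w x ≤ A * w x) ∧
        ∫⁻ x, w x ^ s ∂μ ≤ A * ∫⁻ x, h x ^ s ∂μ := by
  obtain ⟨A₀, hA₀⟩ := IsDyadicSystem.exists_lintegral_max_rpow_le (X := X) (ι := ι) hs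
  have hs0 : 0 < s := by linarith
  set D : ℝ≥0 := (max A₀ 1) ^ (1 / s) with hD
  set B : ℝ≥0 := 2 * D with hB
  have hB0 : B ≠ 0 := by positivity
  refine ⟨max B (2 ^ s), fun c hc μ h hh => ?_⟩
  set m : ℕ → X → ℝ≥0∞ := fun n => (dyadicMax c μ)^[n] h with hm
  have hm0 : m 0 = h := rfl
  have hmS : ∀ n, m (n + 1) = dyadicMax c μ (m n) := fun n =>
    Function.iterate_succ_apply' (dyadicMax c μ) n h
  have hmm : ∀ n, Measurable (m n) := by
    intro n
    cases n with
    | zero => exact hh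
    | succ n => rw [hmS]; exact hc.measurable_max _ _
  set b : ℝ≥0∞ := (B : ℝ≥0∞)⁻¹ with hb
  have hBb : (B : ℝ≥0∞) * b = 1 := ENNReal.mul_inv_cancel (by simpa using hB0) (by simp)
  have hgm : ∀ n, Measurable fun x => b ^ n * m n x := fun n => (hmm n).const_mul _
  refine ⟨fun x => ∑' n, b ^ n * m n x, Measurable.tsum hgm, fun x => ?_, fun x => ?_, ?_⟩
  · simpa [hm0] using ENNReal.le_tsum (f := fun n => b ^ n * m n x) 0
  · calc dyadicMax c μ (fun x => ∑' n, b ^ n * m n x) x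
        ≤ ∑' n, dyadicMax c μ (fun x => b ^ n * m n x) x := dyadicMax_tsum_le c hgm x
      _ = ∑' n, B * (b ^ (n + 1) * m (n + 1) x) := by
          refine tsum_congr fun n => ?_
          rw [dyadicMax_const_mul c (hmm n), hmS, pow_succ,
            show (B : ℝ≥0∞) * (b ^ n * b * dyadicMax c μ (m n) x)
              = (B * b) * (b ^ n * dyadicMax c μ (m n) x) by ring, hBb, one_mul]
      _ = B * ∑' n, b ^ (n + 1) * m (n + 1) x := ENNReal.tsum_mul_left
      _ ≤ (max B (2 ^ s) : ℝ≥0) * ∑' n, b ^ n * m n x := by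
          refine mul_le_mul' (by exact_mod_cast le_max_left _ _) ?_
          exact ENNReal.tsum_comp_le_tsum_of_injective (f := fun n : ℕ => n + 1)
            (add_left_injective 1) fun n => b ^ n * m n x
  · set H := (∫⁻ x, h x ^ s ∂μ) ^ (1 / s) with hH
    have hpow : ∀ a : ℝ≥0∞, (a ^ (1 / s)) ^ s = a := fun a => by
      rw [← ENNReal.rpow_mul, one_div_mul_cancel hs0.ne', ENNReal.rpow_one]
    have hmn : ∀ n, (∫⁻ x, m n x ^ s ∂μ) ^ (1 / s) ≤ D ^ n * H := by
      intro n
      induction n with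
      | zero => simp [hm0, hH]
      | succ n ih =>
        rw [hmS]
        calc (∫⁻ x, dyadicMax c μ (m n) x ^ s ∂μ) ^ (1 / s)
            ≤ ((max A₀ 1 : ℝ≥0) * ∫⁻ x, m n x ^ s ∂μ) ^ (1 / s) := by
              gcongr
              refine (hA₀ c hc μ _ (hmm n)).trans ?_
              gcongr
              exact le_max_left _ _
          _ = D * (∫⁻ x, m n x ^ s ∂μ) ^ (1 / s) := by
              rw [ENNReal.mul_rpow_of_nonneg _ _ (by positivity), hD,
                ENNReal.coe_rpow_of_nonneg _ (by positivity)]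
          _ ≤ D * (D ^ n * H) := by gcongr
          _ = D ^ (n + 1) * H := by ring
    have hbD : b * D = 2⁻¹ := by
      have hDb : (2 * D : ℝ≥0∞) * b = 1 := by simpa [hB] using hBb
      refine ENNReal.eq_inv_of_mul_eq_one_left ?_
      rw [← hDb]; ring
    have hN : (∫⁻ x, (∑' n, b ^ n * m n x) ^ s ∂μ) ^ (1 / s) ≤ 2 * H := by
      calc _ ≤ ∑' n, (∫⁻ x, (b ^ n * m n x) ^ s ∂μ) ^ (1 / s) :=
            lintegral_rpow_tsum_le_tsum hs.le hgm
        _ ≤ ∑' n : ℕ, (2⁻¹ : ℝ≥0∞) ^ n * H := by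
            refine ENNReal.tsum_le_tsum fun n => ?_
            simp_rw [ENNReal.mul_rpow_of_nonneg _ _ hs0.le]
            rw [lintegral_const_mul _ ((hmm n).pow_const s),
              ENNReal.mul_rpow_of_nonneg _ _ (by positivity), ← ENNReal.rpow_mul,
              mul_one_div_cancel hs0.ne', ENNReal.rpow_one]
            calc _ ≤ b ^ n * (D ^ n * H) := by gcongr; exact hmn n
              _ = _ := by rw [← mul_assoc, ← mul_pow, hbD]
        _ = 2 * H := by
            rw [ENNReal.tsum_mul_right, ENNReal.tsum_geometric, ENNReal.one_sub_inv_two, inv_inv]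
    calc ∫⁻ x, (∑' n, b ^ n * m n x) ^ s ∂μ
        = ((∫⁻ x, (∑' n, b ^ n * m n x) ^ s ∂μ) ^ (1 / s)) ^ s := (hpow _).symm
      _ ≤ (2 * H) ^ s := by gcongr
      _ = (2 : ℝ≥0) ^ s * ∫⁻ x, h x ^ s ∂μ := by
          rw [ENNReal.mul_rpow_of_nonneg _ _ hs0.le, hH, hpow]
          simp
      _ ≤ _ := by
          gcongr
          rw [← ENNReal.coe_rpow_of_nonneg _ hs0.le]
          exact_mod_cast le_max_right _ _

/-- the dyadic maximal operator is bounded on `L^r(w)` for every `A₁` weight `w` -/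
theorem IsDyadicSystem.lintegral_max_rpow_mul_le (hc : IsDyadicSystem c) {μ : Measure X}
    (hμ : ∀ k x, μ (dyadicCell c k x) ≠ ∞) {r : ℝ} (hr : 0 < r) {A K : ℝ≥0∞}
    (hK : ∀ (w : Measure X) (f : X → ℝ≥0∞), Measurable f →
      ∫⁻ x, dyadicMax c w f x ^ r ∂w ≤ K * ∫⁻ x, f x ^ r ∂w) (hA : A ≠ ∞)
    {w : X → ℝ≥0∞} (hw : Measurable w) (hwt : ∀ᵐ x ∂μ, w x ≠ ∞)
    (hwA : ∀ k x, ∫⁻ y in dyadicCell c k x, w y ∂μ ≤ A * w x * μ (dyadicCell c k x))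
    {f : X → ℝ≥0∞} (hf : Measurable f) :
    ∫⁻ x, dyadicMax c μ f x ^ r * w x ∂μ ≤ A ^ r * K * ∫⁻ x, f x ^ r * w x ∂μ := by
  set ν := μ.withDensity w with hν
  have hint : ∀ g : X → ℝ≥0∞, Measurable g → ∫⁻ x, g x * w x ∂μ = ∫⁻ x, g x ∂ν := by
    intro g hg
    rw [hν, lintegral_withDensity_eq_lintegral_mul μ hw hg]
    simp [mul_comm]
  have hac : ν ≪ μ := withDensity_absolutelyContinuous μ w
  have hcell : ∀ k x, ν (dyadicCell c k x) * ∫⁻ y in dyadicCell c k x, f y ∂μ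
      ≤ A * μ (dyadicCell c k x) * ∫⁻ y in dyadicCell c k x, f y ∂ν := by
    intro k x
    have hQ := hc.measurableSet_cell k x
    rw [hν, restrict_withDensity hQ, lintegral_withDensity_eq_lintegral_mul _ hw hf,
      ← lintegral_const_mul _ hf, ← lintegral_const_mul _ (hw.mul hf)]
    refine setLIntegral_mono' hQ fun y hy => ?_
    rw [withDensity_apply _ hQ, ← dyadicCell_eq_of_mem hy]
    calc _ ≤ A * w y * μ (dyadicCell c k y) * f y := by gcongr; exact hwA k y
      _ = _ := by simp only [Pi.mul_apply]; ring
  have hpt : ∀ᵐ x ∂ν, dyadicMax c μ f x ≤ A * dyadicMax c ν f x := by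
    filter_upwards [ae_measure_dyadicCell_ne_zero c ν, hac hwt] with x hx0 hxt
    refine iSup_le fun k => ?_
    refine le_trans ?_ (mul_le_mul_right (dyadicAvg_le_dyadicMax c ν f k x) A)
    have hμ0 : μ (dyadicCell c k x) ≠ 0 := fun h => hx0 k (hac h)
    have hνt : ν (dyadicCell c k x) ≠ ∞ := by
      rw [hν, withDensity_apply _ (hc.measurableSet_cell k x)]
      exact ne_top_of_le_ne_top (ENNReal.mul_ne_top (ENNReal.mul_ne_top hA hxt) (hμ k x))
        (hwA k x)
    unfold dyadicAvg
    rw [mul_comm, ← div_eq_mul_inv, ENNReal.div_le_iff hμ0 (hμ k x)]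
    calc ∫⁻ y in dyadicCell c k x, f y ∂μ
        = (ν (dyadicCell c k x))⁻¹ *
            (ν (dyadicCell c k x) * ∫⁻ y in dyadicCell c k x, f y ∂μ) := by
          rw [← mul_assoc, ENNReal.inv_mul_cancel (hx0 k) hνt, one_mul]
      _ ≤ (ν (dyadicCell c k x))⁻¹ *
            (A * μ (dyadicCell c k x) * ∫⁻ y in dyadicCell c k x, f y ∂ν) := by
          exact mul_le_mul_right (hcell k x) _
      _ = _ := by ring
  rw [hint _ ((hc.measurable_max μ f).pow_const r), hint _ (hf.pow_const r)]
  calc ∫⁻ x, dyadicMax c μ f x ^ r ∂ν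
      ≤ ∫⁻ x, A ^ r * dyadicMax c ν f x ^ r ∂ν := by
        refine lintegral_mono_ae (hpt.mono fun x hx => ?_)
        rw [← ENNReal.mul_rpow_of_nonneg _ _ hr.le]
        gcongr
    _ = A ^ r * ∫⁻ x, dyadicMax c ν f x ^ r ∂ν :=
        lintegral_const_mul _ ((hc.measurable_max ν f).pow_const r)
    _ ≤ A ^ r * (K * ∫⁻ x, f x ^ r ∂ν) := by
        gcongr
        exact hK ν f hf
    _ = _ := (mul_assoc _ _ _).symm

/-- the dyadic maximal operator is bounded on `L^r(v^{1-r})` for every positive `A₁` weight `v` -/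
theorem IsDyadicSystem.lintegral_max_rpow_mul_rpow_le (hc : IsDyadicSystem c) {μ : Measure X}
    (hμ : ∀ k x, μ (dyadicCell c k x) ≠ ∞) {r : ℝ} (hr : 0 < r) {A K : ℝ≥0∞}
    (hK : ∀ (w : Measure X) (f : X → ℝ≥0∞), Measurable f →
      ∫⁻ x, dyadicMax c w f x ^ r ∂w ≤ K * ∫⁻ x, f x ^ r ∂w) (hA : A ≠ ∞)
    {v : X → ℝ≥0∞} (hv : Measurable v) (hvt : ∀ᵐ x ∂μ, v x ≠ ∞) (hv0 : ∀ x, v x ≠ 0)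
    (hvA : ∀ k x, ∫⁻ y in dyadicCell c k x, v y ∂μ ≤ A * v x * μ (dyadicCell c k x))
    {f : X → ℝ≥0∞} (hf : Measurable f) :
    ∫⁻ x, dyadicMax c μ f x ^ r * v x ^ (1 - r) ∂μ
      ≤ A ^ r * K * ∫⁻ x, f x ^ r * v x ^ (1 - r) ∂μ := by
  set ν := μ.withDensity v with hν
  set g : X → ℝ≥0∞ := fun x => f x / v x with hg
  have hgm : Measurable g := hf.div hv
  have hvpow : ∀ᵐ x ∂μ, v x ^ r * v x ^ (1 - r) = v x := by
    filter_upwards [hvt] with x hx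
    rw [← ENNReal.rpow_add _ _ (hv0 x) hx, add_sub_cancel, ENNReal.rpow_one]
  have hgv : ∀ᵐ x ∂μ, v x * g x = f x := by
    filter_upwards [hvt] with x hx
    exact ENNReal.mul_div_cancel (hv0 x) hx
  have hpt : ∀ᵐ x ∂μ, dyadicMax c μ f x ≤ A * v x * dyadicMax c ν g x := by
    filter_upwards [ae_measure_dyadicCell_ne_zero c μ, hvt] with x hx0 hxt
    refine iSup_le fun k => ?_
    have hQ := hc.measurableSet_cell k x
    have hνA : ν (dyadicCell c k x) ≤ A * v x * μ (dyadicCell c k x) := by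
      rw [hν, withDensity_apply _ hQ]
      exact hvA k x
    have hνt : ν (dyadicCell c k x) ≠ ∞ :=
      ne_top_of_le_ne_top (ENNReal.mul_ne_top (ENNReal.mul_ne_top hA hxt) (hμ k x)) hνA
    have hfg : ∫⁻ y in dyadicCell c k x, f y ∂μ = ∫⁻ y in dyadicCell c k x, g y ∂ν := by
      rw [hν, restrict_withDensity hQ, lintegral_withDensity_eq_lintegral_mul _ hv hgm]
      exact lintegral_congr_ae ((ae_restrict_of_ae hgv).mono fun y hy => hy.symm)
    rw [dyadicAvg, mul_comm, ← div_eq_mul_inv, ENNReal.div_le_iff (hx0 k) (hμ k x), hfg]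
    rcases eq_or_ne (ν (dyadicCell c k x)) 0 with h0 | h0
    · simp [Measure.restrict_eq_zero.2 h0]
    calc ∫⁻ y in dyadicCell c k x, g y ∂ν = ν (dyadicCell c k x) * dyadicAvg c ν g k x := by
          rw [dyadicAvg, ← mul_assoc, ENNReal.mul_inv_cancel h0 hνt, one_mul]
      _ ≤ A * v x * μ (dyadicCell c k x) * dyadicMax c ν g x :=
          mul_le_mul' hνA (dyadicAvg_le_dyadicMax c ν g k x)
      _ = _ := by ring
  have hMm := (hc.measurable_max ν g).pow_const r
  calc ∫⁻ x, dyadicMax c μ f x ^ r * v x ^ (1 - r) ∂μ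
      ≤ ∫⁻ x, A ^ r * (v x * dyadicMax c ν g x ^ r) ∂μ := by
        refine lintegral_mono_ae ?_
        filter_upwards [hpt, hvpow] with x hx hxv
        calc dyadicMax c μ f x ^ r * v x ^ (1 - r)
            ≤ (A * v x * dyadicMax c ν g x) ^ r * v x ^ (1 - r) := by gcongr
          _ = A ^ r * ((v x ^ r * v x ^ (1 - r)) * dyadicMax c ν g x ^ r) := by
            rw [ENNReal.mul_rpow_of_nonneg _ _ hr.le, ENNReal.mul_rpow_of_nonneg _ _ hr.le]
            ring
          _ = _ := by rw [hxv]
    _ = A ^ r * ∫⁻ x, dyadicMax c ν g x ^ r ∂ν := by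
        rw [lintegral_const_mul (f := fun x => v x * dyadicMax c ν g x ^ r) _ (hv.mul hMm), hν, lintegral_withDensity_eq_lintegral_mul _ hv hMm]
        rfl
    _ ≤ A ^ r * (K * ∫⁻ x, g x ^ r ∂ν) := by
        gcongr
        exact hK ν g hgm
    _ = A ^ r * K * ∫⁻ x, f x ^ r * v x ^ (1 - r) ∂μ := by
        rw [mul_assoc, hν, lintegral_withDensity_eq_lintegral_mul _ hv (hgm.pow_const r)]
        congr 2
        refine lintegral_congr_ae ?_
        filter_upwards [hgv, hvpow] with x hx hxv
        rw [← hx, ENNReal.mul_rpow_of_nonneg _ _ hr.le, Pi.mul_apply]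
        nth_rw 1 [← hxv]
        ring

theorem IsDyadicSystem.exists_vector_valued_of_lt {r p : ℝ} (hr : 1 < r) (hrp : r < p) :
    ∃ C : ℝ≥0, ∀ c : ℤ → X → ι, IsDyadicSystem c → ∀ μ : Measure X,
      (∀ k x, μ (dyadicCell c k x) ≠ ∞) → ∀ f : ℕ → X → ℝ≥0∞, (∀ n, Measurable (f n)) → ∀ N : ℕ,
      ∫⁻ x, (∑ n ∈ Finset.range N, f n x ^ r) ^ (p / r) ∂μ ≠ ∞ →
      ∫⁻ x, (∑ n ∈ Finset.range N, dyadicMax c μ (f n) x ^ r) ^ (p / r) ∂μ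
        ≤ C * ∫⁻ x, (∑ n ∈ Finset.range N, f n x ^ r) ^ (p / r) ∂μ := by
  have hr0 : 0 < r := by linarith
  set q := p / r with hq
  have hq1 : 1 < q := by rw [hq, lt_div_iff₀ hr0]; linarith
  have hq0 : 0 < q := by linarith
  have hrq : r * q = p := by rw [hq]; field_simp
  have hconj := Real.HolderConjugate.conjExponent hq1
  set s := q.conjExponent with hs
  have hs1 : 1 < s := hconj.symm.lt
  have hs0 : 0 < s := by linarith
  obtain ⟨A, hA⟩ := IsDyadicSystem.exists_majorant (X := X) (ι := ι) hs1
  obtain ⟨K, hK⟩ := IsDyadicSystem.exists_lintegral_max_rpow_le (X := X) (ι := ι) hr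
  obtain ⟨K', hK'⟩ :=
    IsDyadicSystem.exists_lintegral_max_rpow_le (X := X) (ι := ι) (hr.trans hrp)
  refine ⟨(A ^ r * K * A ^ (1 / s)) ^ q, fun c hc μ hμ f hf N hV => ?_⟩
  have hM := fun n => hc.measurable_max μ (f n)
  set U : X → ℝ≥0∞ := fun x => ∑ n ∈ Finset.range N, dyadicMax c μ (f n) x ^ r with hU
  set V : X → ℝ≥0∞ := fun x => ∑ n ∈ Finset.range N, f n x ^ r with hVdef
  have hUm : Measurable U := Finset.measurable_fun_sum _ fun n _ => (hM n).pow_const r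
  have hVm : Measurable V := Finset.measurable_fun_sum _ fun n _ => (hf n).pow_const r
  have hUt : ∫⁻ x, U x ^ q ∂μ ≠ ∞ := by
    refine ne_top_of_le_ne_top ?_ (calc
      ∫⁻ x, U x ^ q ∂μ ≤ ∫⁻ x, ((Finset.range N).card : ℝ≥0∞) ^ q *
            ∑ n ∈ Finset.range N, dyadicMax c μ (f n) x ^ p ∂μ := by
          refine lintegral_mono fun x => ?_
          refine (ENNReal.sum_rpow_le_card_rpow_mul_sum _ _ hq0).trans_eq ?_
          simp_rw [← ENNReal.rpow_mul, hrq]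
      _ = ((Finset.range N).card : ℝ≥0∞) ^ q *
            ∑ n ∈ Finset.range N, ∫⁻ x, dyadicMax c μ (f n) x ^ p ∂μ := by
          rw [lintegral_const_mul _ (Finset.measurable_fun_sum _ fun n _ => (hM n).pow_const p),
            lintegral_finsetSum _ fun n _ => (hM n).pow_const p])
    refine ENNReal.mul_ne_top (ENNReal.rpow_ne_top_of_nonneg hq0.le (by simp))
      (ENNReal.sum_ne_top.2 fun n hn => ?_)
    refine ne_top_of_le_ne_top (ENNReal.mul_ne_top (ENNReal.coe_ne_top (r := K')) hV)
      ((hK' c hc μ (f n) (hf n)).trans ?_)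
    gcongr with x
    rw [← hrq, ENNReal.rpow_mul]
    gcongr
    exact Finset.single_le_sum_of_canonicallyOrdered (f := fun n => f n x ^ r) hn
  have hqs : (q - 1) * s = q := by linarith [hconj.sub_one_mul_conj]
  have hhs : ∀ x, (U x ^ (q - 1)) ^ s = U x ^ q := fun x => by rw [← ENNReal.rpow_mul, hqs]
  obtain ⟨w, hwm, hhw, hwA, hws⟩ := hA c hc μ (fun x => U x ^ (q - 1)) (hUm.pow_const _)
  simp_rw [hhs] at hws
  have hwt : ∀ᵐ x ∂μ, w x ≠ ∞ := by
    have h := ae_lt_top (hwm.pow_const s)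
      (ne_top_of_le_ne_top (ENNReal.mul_ne_top ENNReal.coe_ne_top hUt) hws)
    filter_upwards [h] with x hx hxt
    simp [hxt, hs0] at hx
  have hweight : ∫⁻ x, U x * w x ∂μ ≤ A ^ r * K * ∫⁻ x, V x * w x ∂μ := by
    have h : ∀ n, Measurable fun x => dyadicMax c μ (f n) x ^ r * w x := fun n =>
      ((hM n).pow_const r).mul hwm
    have h' : ∀ n, Measurable fun x => f n x ^ r * w x := fun n => ((hf n).pow_const r).mul hwm
    simp_rw [hU, hVdef, Finset.sum_mul]
    rw [lintegral_finsetSum _ fun n _ => h n, lintegral_finsetSum _ fun n _ => h' n,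
      Finset.mul_sum]
    refine Finset.sum_le_sum fun n _ => ?_
    exact hc.lintegral_max_rpow_mul_le hμ hr0 (hK c hc) ENNReal.coe_ne_top hwm hwt
      (fun k x => lintegral_dyadicCell_le (hμ k x) (hwA x)) (hf n)
  set u := ∫⁻ x, U x ^ q ∂μ with hu
  have hmain : u ≤ (A ^ r * K * A ^ (1 / s)) * (∫⁻ x, V x ^ q ∂μ) ^ (1 / q) * u ^ (1 / s) := by
    calc u ≤ ∫⁻ x, U x * w x ∂μ := by
          refine lintegral_mono fun x => ?_
          refine le_trans ?_ (mul_le_mul_right (hhw x) (U x))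
          nth_rw 2 [← ENNReal.rpow_one (U x)]
          rw [← ENNReal.rpow_add_of_nonneg _ _ zero_le_one (by linarith), add_sub_cancel]
      _ ≤ A ^ r * K * ∫⁻ x, V x * w x ∂μ := hweight
      _ ≤ A ^ r * K * ((∫⁻ x, V x ^ q ∂μ) ^ (1 / q) * (∫⁻ x, w x ^ s ∂μ) ^ (1 / s)) := by
          gcongr
          exact ENNReal.lintegral_mul_le_Lp_mul_Lq μ hconj hVm.aemeasurable hwm.aemeasurable
      _ ≤ A ^ r * K * ((∫⁻ x, V x ^ q ∂μ) ^ (1 / q) * (A * u) ^ (1 / s)) := by gcongr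
      _ = _ := by
          rw [ENNReal.mul_rpow_of_nonneg _ _ (by positivity)]
          ring
  rcases eq_or_ne u 0 with h0 | h0
  · simp [h0]
  have hsplit : u = u ^ (1 / q) * u ^ (1 / s) := by
    have h1 : 1 / q + 1 / s = 1 := by simpa using hconj.inv_add_inv_eq_one
    rw [← ENNReal.rpow_add _ _ h0 hUt, h1, ENNReal.rpow_one]
  have hus0 : u ^ (1 / s) ≠ 0 := by simp [h0, hUt]
  have hust : u ^ (1 / s) ≠ ∞ := ENNReal.rpow_ne_top_of_nonneg (by positivity) hUt
  rw [hsplit] at hmain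
  have hmain' : u ^ (1 / q) ≤ (A ^ r * K * A ^ (1 / s)) * (∫⁻ x, V x ^ q ∂μ) ^ (1 / q) := by
    refine (ENNReal.mul_le_mul_iff_left hus0 hust).1 ?_
    rwa [← hsplit] at hmain ⊢
  have := ENNReal.rpow_le_rpow hmain' hq0.le
  rw [ENNReal.mul_rpow_of_nonneg _ _ hq0.le, ← ENNReal.rpow_mul, ← ENNReal.rpow_mul,
    one_div_mul_cancel hq0.ne', ENNReal.rpow_one, ENNReal.rpow_one] at this
  rw [ENNReal.coe_rpow_of_nonneg _ hq0.le]
  push_cast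
  rwa [ENNReal.coe_rpow_of_nonneg _ hr0.le, ENNReal.coe_rpow_of_nonneg _ (by positivity)]

theorem IsDyadicSystem.exists_vector_valued_of_gt {r p : ℝ} (hp : 1 < p) (hpr : p < r) :
    ∃ C : ℝ≥0, ∀ c : ℤ → X → ι, IsDyadicSystem c → ∀ (μ : Measure X) [SigmaFinite μ],
      (∀ k x, μ (dyadicCell c k x) ≠ ∞) → ∀ f : ℕ → X → ℝ≥0∞, (∀ n, Measurable (f n)) → ∀ N : ℕ,
      ∫⁻ x, (∑ n ∈ Finset.range N, f n x ^ r) ^ (p / r) ∂μ ≠ ∞ →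
      ∫⁻ x, (∑ n ∈ Finset.range N, dyadicMax c μ (f n) x ^ r) ^ (p / r) ∂μ
        ≤ C * ∫⁻ x, (∑ n ∈ Finset.range N, f n x ^ r) ^ (p / r) ∂μ := by
  have hr : 1 < r := hp.trans hpr
  have hr0 : 0 < r := by linarith
  have hp0 : 0 < p := by linarith
  set q := p / r with hq
  have hq1 : q < 1 := by rw [hq, div_lt_one hr0]; exact hpr
  have hq0 : 0 < q := by positivity
  have hrq : r * q = p := by rw [hq]; field_simp
  set θ := (r - p) / (r - 1) with hθ
  have hθ0 : 0 < θ := div_pos (by linarith) (by linarith)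
  have hθ1 : θ < 1 := by rw [hθ, div_lt_one (by linarith)]; linarith
  have hθr : θ * (1 - r) = p - r := by
    have : r - 1 ≠ 0 := by linarith
    rw [hθ]; field_simp; ring
  obtain ⟨A, hA⟩ := IsDyadicSystem.exists_majorant (X := X) (ι := ι) hp
  obtain ⟨K, hK⟩ := IsDyadicSystem.exists_lintegral_max_rpow_le (X := X) (ι := ι) hr
  set B : ℝ≥0∞ := ((A : ℝ≥0∞) ^ θ) ^ r * K with hB
  have hAt : (A : ℝ≥0∞) ^ θ ≠ ∞ := ENNReal.rpow_ne_top_of_nonneg hθ0.le ENNReal.coe_ne_top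
  have hBt : B ≠ ∞ :=
    ENNReal.mul_ne_top (ENNReal.rpow_ne_top_of_nonneg hr0.le hAt) ENNReal.coe_ne_top
  set C : ℝ≥0∞ := B ^ q * (A * 2 ^ (p - 1)) with hC
  have hCt : C ≠ ∞ := ENNReal.mul_ne_top (ENNReal.rpow_ne_top_of_nonneg hq0.le hBt)
    (ENNReal.mul_ne_top ENNReal.coe_ne_top
      (ENNReal.rpow_ne_top_of_nonneg (by linarith) (by simp)))
  refine ⟨C.toNNReal, fun c hc μ _ hμ f hf N hV => ?_⟩
  rw [ENNReal.coe_toNNReal hCt]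
  have hM := fun n => hc.measurable_max μ (f n)
  set U : X → ℝ≥0∞ := fun x => ∑ n ∈ Finset.range N, dyadicMax c μ (f n) x ^ r with hU
  set V : X → ℝ≥0∞ := fun x => ∑ n ∈ Finset.range N, f n x ^ r with hVdef
  have hUm : Measurable U := Finset.measurable_fun_sum _ fun n _ => (hM n).pow_const r
  have hVm : Measurable V := Finset.measurable_fun_sum _ fun n _ => (hf n).pow_const r
  have hperturbed : ∀ ε : ℝ≥0∞, ε ≠ 0 → ε ≠ ∞ →
      ∫⁻ x, U x ^ q ∂μ ≤ C * (∫⁻ x, V x ^ q ∂μ + ε) := by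
    intro ε hε0 hεt
    obtain ⟨g, hg0, hgm, hgε⟩ := exists_pos_lintegral_lt_of_sigmaFinite μ hε0
    have hgm' : Measurable fun x => (g x : ℝ≥0∞) := hgm.coe_nnreal_ennreal
    obtain ⟨R, hRm, hFR, hRA, hRp⟩ := hA c hc μ (fun x => V x ^ (1 / r) + (g x : ℝ≥0∞) ^ (1 / p))
      ((hVm.pow_const _).add (hgm'.pow_const _))
    have hFp : ∫⁻ x, (V x ^ (1 / r) + (g x : ℝ≥0∞) ^ (1 / p)) ^ p ∂μ
        ≤ 2 ^ (p - 1) * (∫⁻ x, V x ^ q ∂μ + ε) := by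
      calc _ ≤ ∫⁻ x, 2 ^ (p - 1) * (V x ^ q + g x) ∂μ := by
            refine lintegral_mono fun x => ?_
            refine (ENNReal.rpow_add_le_mul_rpow_add_rpow _ _ hp.le).trans_eq ?_
            rw [← ENNReal.rpow_mul, ← ENNReal.rpow_mul, one_div_mul_cancel hp0.ne',
              ENNReal.rpow_one, one_div_mul_eq_div]
        _ = 2 ^ (p - 1) * (∫⁻ x, V x ^ q ∂μ + ∫⁻ x, g x ∂μ) := by
            have h : Measurable fun x => V x ^ q + (g x : ℝ≥0∞) := (hVm.pow_const q).add hgm'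
            rw [lintegral_const_mul _ h, lintegral_add_right _ hgm']
        _ ≤ _ := by gcongr
    have hRp' : ∫⁻ x, R x ^ p ∂μ ≤ A * 2 ^ (p - 1) * (∫⁻ x, V x ^ q ∂μ + ε) := by
      rw [mul_assoc]
      exact hRp.trans (mul_le_mul_right hFp _)
    have hRpt : ∫⁻ x, R x ^ p ∂μ ≠ ∞ := by
      refine ne_top_of_le_ne_top (ENNReal.mul_ne_top (ENNReal.mul_ne_top ENNReal.coe_ne_top ?_)
        (ENNReal.add_ne_top.2 ⟨hV, hεt⟩)) hRp'
      exact ENNReal.rpow_ne_top_of_nonneg (by linarith) (by simp)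
    have hRt : ∀ᵐ x ∂μ, R x ≠ ∞ := by
      filter_upwards [ae_lt_top (hRm.pow_const p) hRpt] with x hx hxt
      simp [hxt, hp0] at hx
    have hR0 : ∀ x, R x ≠ 0 := by
      intro x hx
      have h := hFR x
      rw [hx] at h
      have h' : (g x : ℝ≥0∞) ^ (1 / p) = 0 := (add_eq_zero.1 (le_zero_iff.1 h)).2
      have hgx := hg0 x
      simp [hp0, hp0.not_gt] at h'
      exact hgx.ne' h'
    have hVR : ∀ x, V x ≤ R x ^ r := fun x => by
      calc V x = (V x ^ (1 / r)) ^ r := by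
            rw [← ENNReal.rpow_mul, one_div_mul_cancel hr0.ne', ENNReal.rpow_one]
        _ ≤ R x ^ r := by
            gcongr
            exact le_self_add.trans (hFR x)
    have hweight : ∫⁻ x, U x * R x ^ (p - r) ∂μ ≤ B * ∫⁻ x, V x * R x ^ (p - r) ∂μ := by
      have h : ∀ n, Measurable fun x => dyadicMax c μ (f n) x ^ r * R x ^ (p - r) := fun n =>
        ((hM n).pow_const r).mul (hRm.pow_const _)
      have h' : ∀ n, Measurable fun x => f n x ^ r * R x ^ (p - r) := fun n =>
        ((hf n).pow_const r).mul (hRm.pow_const _)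
      simp_rw [hU, hVdef, Finset.sum_mul]
      rw [lintegral_finsetSum _ fun n _ => h n, lintegral_finsetSum _ fun n _ => h' n,
        Finset.mul_sum]
      refine Finset.sum_le_sum fun n _ => ?_
      have h := hc.lintegral_max_rpow_mul_rpow_le hμ hr0 (hK c hc) hAt
        (v := fun x => R x ^ θ) (hRm.pow_const θ)
        (hRt.mono fun x hx => ENNReal.rpow_ne_top_of_nonneg hθ0.le hx)
        (fun x => by simp [hR0 x, hθ0.not_gt])
        (fun k x => lintegral_dyadicCell_rpow_le hRm hθ0 hθ1
          (lintegral_dyadicCell_le (hμ k x) (hRA x))) (hf n)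
      simpa only [hB, ← ENNReal.rpow_mul, hθr] using h
    have hVW : ∫⁻ x, V x * R x ^ (p - r) ∂μ ≤ ∫⁻ x, R x ^ p ∂μ := by
      refine lintegral_mono_ae (hRt.mono fun x hx => ?_)
      calc V x * R x ^ (p - r) ≤ R x ^ r * R x ^ (p - r) := by gcongr; exact hVR x
        _ = R x ^ p := by rw [← ENNReal.rpow_add _ _ (hR0 x) hx, add_sub_cancel]
    have hsplit : ∀ᵐ x ∂μ, U x ^ q = (U x * R x ^ (p - r)) ^ q * (R x ^ p) ^ (1 - q) := by
      filter_upwards [hRt] with x hx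
      rw [ENNReal.mul_rpow_of_nonneg _ _ hq0.le, mul_assoc, ← ENNReal.rpow_mul, ← ENNReal.rpow_mul,
        ← ENNReal.rpow_add _ _ (hR0 x) hx,
        show (p - r) * q + p * (1 - q) = 0 by linear_combination -hrq, ENNReal.rpow_zero, mul_one]
    calc ∫⁻ x, U x ^ q ∂μ
        = ∫⁻ x, (U x * R x ^ (p - r)) ^ q * (R x ^ p) ^ (1 - q) ∂μ := lintegral_congr_ae hsplit
      _ ≤ (∫⁻ x, U x * R x ^ (p - r) ∂μ) ^ q * (∫⁻ x, R x ^ p ∂μ) ^ (1 - q) :=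
          ENNReal.lintegral_mul_norm_pow_le (hUm.mul (hRm.pow_const _)).aemeasurable
            (hRm.pow_const _).aemeasurable hq0.le (by linarith) (by ring)
      _ ≤ (B * ∫⁻ x, R x ^ p ∂μ) ^ q * (∫⁻ x, R x ^ p ∂μ) ^ (1 - q) := by
          gcongr
          exact hweight.trans (mul_le_mul_right hVW _)
      _ = B ^ q * ∫⁻ x, R x ^ p ∂μ := by
          rw [ENNReal.mul_rpow_of_nonneg _ _ hq0.le, mul_assoc,
            ← ENNReal.rpow_add_of_nonneg _ _ hq0.le (by linarith), add_sub_cancel,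
            ENNReal.rpow_one]
      _ ≤ B ^ q * (A * 2 ^ (p - 1) * (∫⁻ x, V x ^ q ∂μ + ε)) := by gcongr
      _ = _ := by rw [hC]; ring
  refine ENNReal.le_of_forall_pos_le_add fun ε hε _ => ?_
  have hC1 : C + 1 ≠ ∞ := ENNReal.add_ne_top.2 ⟨hCt, ENNReal.one_ne_top⟩
  refine (hperturbed (ε / (C + 1)) ?_ ?_).trans ?_
  · exact (ENNReal.div_pos (by exact_mod_cast hε.ne') hC1).ne'
  · exact ENNReal.div_ne_top ENNReal.coe_ne_top (by simp)
  · rw [mul_add]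
    gcongr
    calc C * (ε / (C + 1)) ≤ (C + 1) * (ε / (C + 1)) := by
          gcongr
          exact le_self_add
      _ = ε := ENNReal.mul_div_cancel (by simp) hC1

/-- the Fefferman–Stein inequality for finitely many functions and a dyadic maximal operator -/
theorem IsDyadicSystem.exists_vector_valued {r p : ℝ} (hr : 1 < r) (hp : 1 < p) :
    ∃ C : ℝ≥0, ∀ c : ℤ → X → ι, IsDyadicSystem c → ∀ (μ : Measure X) [SigmaFinite μ],
      (∀ k x, μ (dyadicCell c k x) ≠ ∞) → ∀ f : ℕ → X → ℝ≥0∞, (∀ n, Measurable (f n)) → ∀ N : ℕ,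
      ∫⁻ x, (∑ n ∈ Finset.range N, f n x ^ r) ^ (p / r) ∂μ ≠ ∞ →
      ∫⁻ x, (∑ n ∈ Finset.range N, dyadicMax c μ (f n) x ^ r) ^ (p / r) ∂μ
        ≤ C * ∫⁻ x, (∑ n ∈ Finset.range N, f n x ^ r) ^ (p / r) ∂μ := by
  rcases lt_trichotomy p r with h | rfl | h
  · exact IsDyadicSystem.exists_vector_valued_of_gt hp h
  · obtain ⟨K, hK⟩ := IsDyadicSystem.exists_lintegral_max_rpow_le (X := X) (ι := ι) hp
    refine ⟨K, fun c hc μ _ _ f hf N _ => ?_⟩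
    simp_rw [div_self (by linarith : p ≠ 0), ENNReal.rpow_one]
    rw [lintegral_finsetSum _ fun n _ => (hc.measurable_max μ (f n)).pow_const p,
      lintegral_finsetSum _ fun n _ => (hf n).pow_const p, Finset.mul_sum]
    exact Finset.sum_le_sum fun n _ => hK c hc μ (f n) (hf n)
  · obtain ⟨C, hC⟩ := IsDyadicSystem.exists_vector_valued_of_lt (X := X) (ι := ι) hr h
    exact ⟨C, fun c hc μ _ => hC c hc μ⟩

theorem IsDyadicSystem.exists_vector_valued_tsum {r p : ℝ} (hr : 1 < r) (hp : 1 < p) :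
    ∃ C : ℝ≥0, ∀ c : ℤ → X → ι, IsDyadicSystem c → ∀ (μ : Measure X) [SigmaFinite μ],
      (∀ k x, μ (dyadicCell c k x) ≠ ∞) → ∀ f : ℕ → X → ℝ≥0∞, (∀ n, Measurable (f n)) →
      ∫⁻ x, (∑' n, f n x ^ r) ^ (p / r) ∂μ ≠ ∞ →
      ∫⁻ x, (∑' n, dyadicMax c μ (f n) x ^ r) ^ (p / r) ∂μ
        ≤ C * ∫⁻ x, (∑' n, f n x ^ r) ^ (p / r) ∂μ := by
  have hq : 0 < p / r := by apply div_pos <;> linarith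
  obtain ⟨C, hC⟩ := IsDyadicSystem.exists_vector_valued (X := X) (ι := ι) hr hp
  refine ⟨C, fun c hc μ _ hμ f hf hV => ?_⟩
  have hle : ∀ N, ∫⁻ x, (∑ n ∈ Finset.range N, f n x ^ r) ^ (p / r) ∂μ
      ≤ ∫⁻ x, (∑' n, f n x ^ r) ^ (p / r) ∂μ := fun N => by
    gcongr with x
    exact ENNReal.sum_le_tsum _
  have hsup : ∀ x, (∑' n, dyadicMax c μ (f n) x ^ r) ^ (p / r)
      = ⨆ N, (∑ n ∈ Finset.range N, dyadicMax c μ (f n) x ^ r) ^ (p / r) := fun x => by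
    rw [ENNReal.tsum_eq_iSup_nat]
    exact (ENNReal.orderIsoRpow _ hq).map_iSup _
  simp_rw [hsup]
  rw [lintegral_iSup]
  · exact iSup_le fun N => (hC c hc μ hμ f hf N (ne_top_of_le_ne_top hV (hle N))).trans
      (mul_le_mul_right (hle N) _)
  · exact fun N => (Finset.measurable_fun_sum _ fun n _ =>
      (hc.measurable_max μ (f n)).pow_const r).pow_const _
  · intro M N hMN x
    dsimp only
    gcongr

end Dyadic

/-- the label of the interval of length `2⁻ᵏ` containing `u`, in the standard dyadic grid or in the
dyadic grid shifted by one third -/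
def shiftedFloor (b : Bool) (k : ℤ) (u : ℝ) : ℤ :=
  ⌊2 ^ k * u - if b then (-1) ^ k / 3 else 0⌋

theorem measurable_shiftedFloor (b : Bool) (k : ℤ) : Measurable (shiftedFloor b k) :=
  Int.measurable_floor.comp ((measurable_id.const_mul _).sub_const _)

theorem shiftedFloor_eq_of_succ {b : Bool} {k : ℤ} {u v : ℝ}
    (h : shiftedFloor b (k + 1) u = shiftedFloor b (k + 1) v) :
    shiftedFloor b k u = shiftedFloor b k v := by
  have floor_half : ∀ a : ℝ, ⌊a⌋ = ⌊2 * a⌋ / 2 := fun a => by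
    have h1 := Int.floor_le (2 * a)
    have h2 := Int.lt_floor_add_one (2 * a)
    have h3 : 2 * (⌊2 * a⌋ / 2) ≤ ⌊2 * a⌋ := by omega
    have h4 : ⌊2 * a⌋ ≤ 2 * (⌊2 * a⌋ / 2) + 1 := by omega
    have h3' : (2 : ℝ) * ((⌊2 * a⌋ / 2 : ℤ) : ℝ) ≤ ⌊2 * a⌋ := by exact_mod_cast h3
    have h4' : (⌊2 * a⌋ : ℝ) ≤ 2 * ((⌊2 * a⌋ / 2 : ℤ) : ℝ) + 1 := by exact_mod_cast h4
    rw [Int.floor_eq_iff]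
    constructor <;> linarith
  obtain ⟨e, he⟩ : ∃ e : ℤ, ∀ w : ℝ, (2 ^ (k + 1) * w - if b then (-1) ^ (k + 1) / 3 else 0)
      = 2 * (2 ^ k * w - if b then (-1) ^ k / 3 else 0) + e := by
    rw [zpow_add_one₀ two_ne_zero, zpow_add_one₀ (by norm_num : (-1 : ℝ) ≠ 0)]
    cases b
    · exact ⟨0, fun w => by simp; ring⟩
    · rcases Int.even_or_odd k with hk | hk
      · exact ⟨1, fun w => by rw [hk.neg_one_zpow]; push_cast; simp only [if_true]; ring⟩
      · exact ⟨-1, fun w => by rw [hk.neg_one_zpow]; push_cast; simp only [if_true]; ring⟩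
  simp only [shiftedFloor, he, Int.floor_add_intCast, add_left_inj] at h ⊢
  rw [floor_half, h, ← floor_half]

theorem abs_sub_lt_of_shiftedFloor_eq {b : Bool} {k : ℤ} {u v : ℝ}
    (h : shiftedFloor b k u = shiftedFloor b k v) : |u - v| < (2 ^ k)⁻¹ := by
  have h2 : (0 : ℝ) < 2 ^ k := by positivity
  have h' := Int.abs_sub_lt_one_of_floor_eq_floor h
  rw [sub_sub_sub_cancel_right, ← mul_sub, abs_mul, abs_of_pos h2] at h'
  rwa [← mul_one (2 ^ k)⁻¹, lt_inv_mul_iff₀ h2]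

/-- a short interval does not meet the endpoints of one of the two dyadic grids -/
theorem exists_shiftedFloor_eq {k : ℤ} {A B : ℝ} (hAB : 2 ^ k * (B - A) ≤ 1 / 3) :
    ∃ b, ∀ u ∈ Ico A B, ∀ v ∈ Ico A B, shiftedFloor b k u = shiftedFloor b k v := by
  have h2 : (0 : ℝ) < 2 ^ k := by positivity
  suffices ∃ b, ∃ m : ℤ, ∀ u ∈ Ico A B, shiftedFloor b k u = m by
    obtain ⟨b, m, h⟩ := this
    exact ⟨b, fun u hu v hv => (h u hu).trans (h v hv).symm⟩
  have hA : ∀ u ∈ Ico A B, 2 ^ k * A ≤ 2 ^ k * u := fun u hu => by gcongr; exact hu.1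
  have hB : ∀ u ∈ Ico A B, 2 ^ k * u < 2 ^ k * B := fun u hu => by gcongr; exact hu.2
  have hm := Int.floor_le (2 ^ k * A)
  have hm' := Int.lt_floor_add_one (2 ^ k * A)
  simp only [shiftedFloor, Int.floor_eq_iff]
  by_cases h : 2 ^ k * B ≤ ⌊2 ^ k * A⌋ + 1
  · refine ⟨false, ⌊2 ^ k * A⌋, fun u hu => ?_⟩
    have h3 := hA u hu
    have h4 := hB u hu
    simp only [Bool.false_eq_true, if_false]
    constructor <;> linarith
  · rcases Int.even_or_odd k with hk | hk
    · refine ⟨true, ⌊2 ^ k * A⌋, fun u hu => ?_⟩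
      have h3 := hA u hu
      have h4 := hB u hu
      simp only [if_true, hk.neg_one_zpow]
      constructor <;> linarith
    · refine ⟨true, ⌊2 ^ k * A⌋ + 1, fun u hu => ?_⟩
      have h3 := hA u hu
      have h4 := hB u hu
      simp only [if_true, hk.neg_one_zpow]
      push_cast
      constructor <;> linarith

/-- the partition of `ℝ^d` at level `k` into reflection invariant cells, with the grid in the
`j`-th coordinate selected by `t j` -/
def reflGrid (d : ℕ) (t : Fin d → Bool) (k : ℤ) (y : Fin d → ℝ) : Fin d → ℤ :=
  fun j => shiftedFloor (t j) k |y j|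

theorem isDyadicSystem_reflGrid (d : ℕ) (t : Fin d → Bool) : IsDyadicSystem (reflGrid d t) where
  measurable k := measurable_pi_lambda _ fun j =>
    (measurable_shiftedFloor (t j) k).comp (measurable_pi_apply j).abs
  refines _ _ _ h := funext fun j => shiftedFloor_eq_of_succ (congrFun h j)

theorem dyadicCell_reflGrid_subset {d : ℕ} (t : Fin d → Bool) {k : ℤ} (x : Fin d → ℝ) {ℓ : ℝ}
    (hℓ : (2 ^ k)⁻¹ ≤ ℓ) :
    dyadicCell (reflGrid d t) k x ⊆ univ.pi fun j => {u | |(|u| - |x j|)| < ℓ} :=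
  fun _ hy j _ => (abs_sub_lt_of_shiftedFloor_eq (congrFun hy j)).trans_le hℓ

theorem exists_subset_dyadicCell {d : ℕ} (x : Fin d → ℝ) {ρ : ℝ} (hρ : 0 < ρ) {k : ℤ}
    (hk : 2 ^ k ≤ 1 / (6 * ρ)) :
    ∃ t, {y : Fin d → ℝ | (fun j => |y j|) ∈ Rset d x ρ} ⊆ dyadicCell (reflGrid d t) k x := by
  have hk' : ∀ j, (2 : ℝ) ^ k * (|x j| + ρ - (|x j| - ρ)) ≤ 1 / 3 := fun j => by
    rw [le_div_iff₀ (by positivity)] at hk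
    linarith
  choose t ht using fun j => exists_shiftedFloor_eq (hk' j)
  refine ⟨t, fun y hy => funext fun j => ht j _ ?_ _ ⟨by linarith, by linarith⟩⟩
  have h := hy j (mem_univ j)
  exact ⟨(le_max_right _ _).trans h.1, h.2⟩

theorem muK_pi_le {d : ℕ} {κ : Fin d → ℝ} (hκ : ∀ j, 0 ≤ κ j) {S : Fin d → Set ℝ} {a : Fin d → ℝ}
    (ha : ∀ j, ∀ u ∈ S j, |u| ≤ a j) :
    muK d κ (univ.pi S) ≤ ∏ j, ENNReal.ofReal (a j ^ (2 * κ j)) * volume (S j) := by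
  rw [muK, withDensity_apply', Finset.prod_mul_distrib, ← volume_pi_pi, ← setLIntegral_const]
  refine setLIntegral_mono measurable_const fun y hy => ?_
  rw [ENNReal.ofReal_prod_of_nonneg fun j _ => by positivity]
  gcongr with j
  · exact mul_nonneg zero_le_two (hκ j)
  · exact ha j _ (hy j (mem_univ j))

theorem le_muK_pi {d : ℕ} {κ : Fin d → ℝ} (hκ : ∀ j, 0 ≤ κ j) {S : Fin d → Set ℝ} {a : Fin d → ℝ}
    (hS : ∀ j, MeasurableSet (S j)) (ha0 : ∀ j, 0 ≤ a j) (ha : ∀ j, ∀ u ∈ S j, a j ≤ |u|) :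
    ∏ j, ENNReal.ofReal (a j ^ (2 * κ j)) * volume (S j) ≤ muK d κ (univ.pi S) := by
  rw [muK, withDensity_apply', Finset.prod_mul_distrib, ← volume_pi_pi, ← setLIntegral_const]
  refine setLIntegral_mono' (MeasurableSet.univ_pi hS) fun y hy => ?_
  rw [ENNReal.ofReal_prod_of_nonneg fun j _ => by positivity]
  gcongr with j
  · exact ha0 j
  · exact mul_nonneg zero_le_two (hκ j)
  · exact ha j _ (hy j (mem_univ j))

theorem muK_reflBox_le {d : ℕ} {κ : Fin d → ℝ} (hκ : ∀ j, 0 ≤ κ j) (x : Fin d → ℝ) (ℓ : ℝ) :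
    muK d κ (univ.pi fun j => {u | |(|u| - |x j|)| < ℓ})
      ≤ ∏ j, ENNReal.ofReal ((|x j| + ℓ) ^ (2 * κ j)) * ENNReal.ofReal (4 * ℓ) := by
  refine (muK_pi_le hκ (a := fun j => |x j| + ℓ) fun j u hu => ?_).trans ?_
  · have hu' : |(|u| - |x j|)| < ℓ := hu
    linarith [(abs_lt.1 hu').2]
  gcongr with j
  have hsub : {u : ℝ | |(|u| - |x j|)| < ℓ}
      ⊆ Ioo (|x j| - ℓ) (|x j| + ℓ) ∪ Ioo (-|x j| - ℓ) (-|x j| + ℓ) := fun u hu => by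
    have hu' : |(|u| - |x j|)| < ℓ := hu
    have h := abs_lt.1 hu'
    rcases abs_cases u with ⟨_, _⟩ | ⟨_, _⟩
    · exact Or.inl ⟨by linarith, by linarith⟩
    · exact Or.inr ⟨by linarith, by linarith⟩
  refine (measure_mono hsub).trans ((measure_union_le _ _).trans ?_)
  rcases le_total ℓ 0 with hℓ | hℓ
  · simp [Ioo_eq_empty_of_le, show |x j| + ℓ ≤ |x j| - ℓ by linarith,
      show -|x j| + ℓ ≤ -|x j| - ℓ by linarith]
  · rw [Real.volume_Ioo, Real.volume_Ioo, ← ENNReal.ofReal_add (by linarith) (by linarith)]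
    exact ENNReal.ofReal_le_ofReal (by linarith)

theorem le_muK_Rset {d : ℕ} {κ : Fin d → ℝ} (hκ : ∀ j, 0 ≤ κ j) (x : Fin d → ℝ) {ρ : ℝ}
    (hρ : 0 < ρ) :
    ∏ j, ENNReal.ofReal ((|x j| + ρ / 2) ^ (2 * κ j)) * ENNReal.ofReal (ρ / 2)
      ≤ muK d κ (Rset d x ρ) := by
  calc _ = ∏ j, ENNReal.ofReal ((|x j| + ρ / 2) ^ (2 * κ j)) *
        volume (Ico (|x j| + ρ / 2) (|x j| + ρ)) := by
        refine Finset.prod_congr rfl fun j _ => ?_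
        rw [Real.volume_Ico]
        congr 2
        ring
    _ ≤ muK d κ (univ.pi fun j => Ico (|x j| + ρ / 2) (|x j| + ρ)) :=
        le_muK_pi hκ (fun j => measurableSet_Ico) (fun j => by positivity)
          fun j u hu => hu.1.trans (le_abs_self u)
    _ ≤ muK d κ (Rset d x ρ) := by
        refine measure_mono (pi_mono fun j _ => Ico_subset_Ico_left ?_)
        exact max_le (by positivity) (by linarith)

theorem muK_reflBox_le_mul_muK_Rset {d : ℕ} {κ : Fin d → ℝ} (hκ : ∀ j, 0 ≤ κ j) (x : Fin d → ℝ)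
    {ρ : ℝ} (hρ : 0 < ρ) :
    muK d κ (univ.pi fun j => {u | |(|u| - |x j|)| < 12 * ρ})
      ≤ (∏ j, ENNReal.ofReal (24 ^ (2 * κ j) * 96)) * muK d κ (Rset d x ρ) := by
  refine (muK_reflBox_le hκ x _).trans
    (le_trans ?_ (mul_le_mul_right (le_muK_Rset hκ x hρ) _))
  rw [← Finset.prod_mul_distrib]
  refine Finset.prod_le_prod' fun j _ => ?_
  rw [← ENNReal.ofReal_mul (by positivity), ← ENNReal.ofReal_mul (by positivity),
    ← ENNReal.ofReal_mul (by positivity)]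
  refine ENNReal.ofReal_le_ofReal ?_
  calc (|x j| + 12 * ρ) ^ (2 * κ j) * (4 * (12 * ρ))
      ≤ (24 * (|x j| + ρ / 2)) ^ (2 * κ j) * (4 * (12 * ρ)) := by
        gcongr
        · exact mul_nonneg zero_le_two (hκ j)
        · linarith [abs_nonneg (x j)]
    _ = _ := by
        rw [Real.mul_rpow (by norm_num) (by positivity)]
        ring

theorem muK_dyadicCell_ne_top {d : ℕ} {κ : Fin d → ℝ} (hκ : ∀ j, 0 ≤ κ j) (t : Fin d → Bool)
    (k : ℤ) (x : Fin d → ℝ) : muK d κ (dyadicCell (reflGrid d t) k x) ≠ ∞ :=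
  ne_top_of_le_ne_top
    (ENNReal.prod_ne_top fun _ _ => ENNReal.mul_ne_top ENNReal.ofReal_ne_top ENNReal.ofReal_ne_top)
    ((measure_mono (dyadicCell_reflGrid_subset t x le_rfl)).trans (muK_reflBox_le hκ x _))

/-- `M_κ^R` is dominated by finitely many dyadic maximal operators -/
theorem MR_le_mul_sum_dyadicMax {d : ℕ} {κ : Fin d → ℝ} (hκ : ∀ j, 0 ≤ κ j)
    (f : (Fin d → ℝ) → ℝ) (x : Fin d → ℝ) :
    MR d κ f x ≤ (∏ j, ENNReal.ofReal (24 ^ (2 * κ j) * 96)) *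
      ∑ t, dyadicMax (reflGrid d t) (muK d κ) (fun y => ENNReal.ofReal |f y|) x := by
  set C := ∏ j, ENNReal.ofReal (24 ^ (2 * κ j) * 96) with hC
  have hC0 : C ≠ 0 := Finset.prod_ne_zero_iff.2 fun j _ =>
    (ENNReal.ofReal_pos.2 (by positivity)).ne'
  have hCt : C ≠ ∞ := ENNReal.prod_ne_top fun _ _ => ENNReal.ofReal_ne_top
  refine iSup₂_le fun ρ hρ => ?_
  obtain ⟨k, hk, hk'⟩ := exists_mem_Ico_zpow (show 0 < 1 / (6 * ρ) by positivity) one_lt_two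
  obtain ⟨t, ht⟩ := exists_subset_dyadicCell x hρ hk
  have hcell : muK d κ (dyadicCell (reflGrid d t) k x) ≤ C * muK d κ (Rset d x ρ) := by
    refine (measure_mono (dyadicCell_reflGrid_subset t x ?_)).trans
      (muK_reflBox_le_mul_muK_Rset hκ x hρ)
    rw [zpow_add_one₀ two_ne_zero, div_lt_iff₀ (by positivity)] at hk'
    rw [inv_le_iff_one_le_mul₀' (by positivity)]
    linarith
  calc _ ≤ C * (muK d κ (dyadicCell (reflGrid d t) k x))⁻¹ *
        ∫⁻ y in dyadicCell (reflGrid d t) k x, ENNReal.ofReal |f y| ∂(muK d κ) := by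
        refine mul_le_mul' ?_ (lintegral_mono_set ht)
        calc (muK d κ (Rset d x ρ))⁻¹ = C * (C * muK d κ (Rset d x ρ))⁻¹ := by
              rw [ENNReal.mul_inv (Or.inl hC0) (Or.inl hCt), ← mul_assoc,
                ENNReal.mul_inv_cancel hC0 hCt, one_mul]
          _ ≤ _ := by gcongr
    _ = C * dyadicAvg (reflGrid d t) (muK d κ) (fun y => ENNReal.ofReal |f y|) k x := by
        rw [dyadicAvg, mul_assoc]
    _ ≤ _ := by
        gcongr
        exact (dyadicAvg_le_dyadicMax _ _ _ k x).trans
          (Finset.single_le_sum_of_canonicallyOrdered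
            (f := fun t => dyadicMax (reflGrid d t) (muK d κ) _ x) (Finset.mem_univ t))

/-- Fefferman–Stein inequality for `M_κ^R`, for the `p`-th powers of the norms -/
theorem exists_lintegral_tsum_MR_rpow_le {d : ℕ} {κ : Fin d → ℝ} (hκ : ∀ j, 0 ≤ κ j) {r p : ℝ}
    (hr : 1 < r) (hp : 1 < p) :
    ∃ C : ℝ≥0, ∀ f : ℕ → (Fin d → ℝ) → ℝ, (∀ n, Measurable (f n)) →
      ∫⁻ x, (∑' n, ENNReal.ofReal |f n x| ^ r) ^ (p / r) ∂(muK d κ) ≠ ∞ →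
      ∫⁻ x, (∑' n, MR d κ (f n) x ^ r) ^ (p / r) ∂(muK d κ)
        ≤ C * ∫⁻ x, (∑' n, ENNReal.ofReal |f n x| ^ r) ^ (p / r) ∂(muK d κ) := by
  have hr0 : 0 < r := by linarith
  have hq : 0 < p / r := by apply div_pos <;> linarith
  obtain ⟨C, hC⟩ := IsDyadicSystem.exists_vector_valued_tsum (X := Fin d → ℝ) (ι := Fin d → ℤ) hr hp
  set D : ℝ≥0∞ := ∏ j, ENNReal.ofReal (24 ^ (2 * κ j) * 96) with hD
  set n₀ : ℝ≥0∞ := ((Finset.univ : Finset (Fin d → Bool)).card : ℝ≥0∞) with hn₀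
  set E : ℝ≥0∞ := (D ^ r * n₀ ^ r) ^ (p / r) * n₀ ^ (p / r) with hE
  have hDt : D ≠ ∞ := ENNReal.prod_ne_top fun _ _ => ENNReal.ofReal_ne_top
  have hn₀t : n₀ ≠ ∞ := ENNReal.natCast_ne_top _
  have hEt : E ≠ ∞ := ENNReal.mul_ne_top
    (ENNReal.rpow_ne_top_of_nonneg hq.le (ENNReal.mul_ne_top
      (ENNReal.rpow_ne_top_of_nonneg hr0.le hDt) (ENNReal.rpow_ne_top_of_nonneg hr0.le hn₀t)))
    (ENNReal.rpow_ne_top_of_nonneg hq.le hn₀t)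
  refine ⟨(E * (n₀ * C)).toNNReal, fun f hf hV => ?_⟩
  rw [ENNReal.coe_toNNReal (ENNReal.mul_ne_top hEt (ENNReal.mul_ne_top hn₀t ENNReal.coe_ne_top))]
  set μ := muK d κ with hμ
  have : SigmaFinite μ := SigmaFinite.withDensity_ofReal _
  set g : ℕ → (Fin d → ℝ) → ℝ≥0∞ := fun n y => ENNReal.ofReal |f n y| with hg
  have hgm : ∀ n, Measurable (g n) := fun n => (hf n).abs.ennreal_ofReal
  set G : (Fin d → Bool) → (Fin d → ℝ) → ℝ≥0∞ := fun t x =>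
    (∑' n, dyadicMax (reflGrid d t) μ (g n) x ^ r) ^ (p / r) with hG
  have hGm : ∀ t, Measurable (G t) := fun t => (Measurable.tsum fun n =>
    ((isDyadicSystem_reflGrid d t).measurable_max μ (g n)).pow_const r).pow_const _
  have hpt : ∀ x, (∑' n, MR d κ (f n) x ^ r) ^ (p / r) ≤ E * ∑ t, G t x := fun x => by
    calc (∑' n, MR d κ (f n) x ^ r) ^ (p / r)
        ≤ (∑' n, D ^ r * n₀ ^ r * ∑ t, dyadicMax (reflGrid d t) μ (g n) x ^ r) ^ (p / r) := by
          gcongr with n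
          refine (ENNReal.rpow_le_rpow (MR_le_mul_sum_dyadicMax hκ (f n) x) hr0.le).trans ?_
          rw [ENNReal.mul_rpow_of_nonneg _ _ hr0.le, mul_assoc]
          gcongr
          exact ENNReal.sum_rpow_le_card_rpow_mul_sum _ _ hr0
      _ = (D ^ r * n₀ ^ r) ^ (p / r) *
            (∑ t, ∑' n, dyadicMax (reflGrid d t) μ (g n) x ^ r) ^ (p / r) := by
          rw [ENNReal.tsum_mul_left, ENNReal.mul_rpow_of_nonneg _ _ hq.le,
            Summable.tsum_finsetSum fun _ _ => ENNReal.summable]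
      _ ≤ (D ^ r * n₀ ^ r) ^ (p / r) * (n₀ ^ (p / r) * ∑ t, G t x) := by
          gcongr
          exact ENNReal.sum_rpow_le_card_rpow_mul_sum _ _ hq
      _ = _ := by rw [hE, mul_assoc]
  calc ∫⁻ x, (∑' n, MR d κ (f n) x ^ r) ^ (p / r) ∂μ ≤ ∫⁻ x, E * ∑ t, G t x ∂μ :=
        lintegral_mono hpt
    _ = E * ∑ t, ∫⁻ x, G t x ∂μ := by
        rw [lintegral_const_mul _ (Finset.measurable_fun_sum _ fun t _ => hGm t),
          lintegral_finsetSum _ fun t _ => hGm t]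
    _ ≤ E * ∑ _t : Fin d → Bool, C * ∫⁻ x, (∑' n, g n x ^ r) ^ (p / r) ∂μ := by
        gcongr with t
        exact hC _ (isDyadicSystem_reflGrid d t) μ (muK_dyadicCell_ne_top hκ t) g hgm hV
    _ = _ := by
        rw [Finset.sum_const, nsmul_eq_mul]
        ring

/-- Fefferman–Stein inequalities for `M_κ^R`: strong type. -/
theorem fefferman_stein_MR_strong
    (d : ℕ) (hd : 1 ≤ d) (κ : Fin d → ℝ) (hκ : ∀ j, 0 ≤ κ j)
    (r p : ℝ) (hr : 1 < r) (hp : 1 < p) :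
    ∃ C : ℝ, 0 < C ∧ ∀ f : ℕ → (Fin d → ℝ) → ℝ, (∀ n, Measurable (f n)) →
      (∫⁻ x, ((∑' n, ENNReal.ofReal (|f n x|) ^ r) ^ (1/r)) ^ p ∂(muK d κ)) ^ (1/p) < ∞ →
      (∫⁻ x, ((∑' n, MR d κ (f n) x ^ r) ^ (1/r)) ^ p ∂(muK d κ)) ^ (1/p) ≤
        ENNReal.ofReal C *
          (∫⁻ x, ((∑' n, ENNReal.ofReal (|f n x|) ^ r) ^ (1/r)) ^ p ∂(muK d κ)) ^ (1/p) := by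
  have hp0 : 0 < p := by linarith
  obtain ⟨C, hC⟩ := exists_lintegral_tsum_MR_rpow_le hκ hr hp
  refine ⟨((C + 1 : ℝ≥0) : ℝ) ^ (1 / p), by positivity, fun f hf hfin => ?_⟩
  simp_rw [← ENNReal.rpow_mul, one_div_mul_eq_div] at hfin ⊢
  have hV : ∫⁻ x, (∑' n, ENNReal.ofReal |f n x| ^ r) ^ (p / r) ∂(muK d κ) ≠ ∞ := fun h => by
    simp [h, hp0] at hfin
  rw [← ENNReal.ofReal_rpow_of_nonneg (C + 1).coe_nonneg (by positivity), ENNReal.ofReal_coe_nnreal,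
    ← ENNReal.mul_rpow_of_nonneg _ _ (by positivity)]
  gcongr
  refine (hC f hf hV).trans ?_
  gcongr
  exact le_self_add
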